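/- arXiv:2408.06589 — 16 statements merged into one kernel-verified Lean document; each statement's English description precedes it below -/
import Mathlib

section
/- Let φ, ψ ∈ GL₂(ℤ) be such that the pair (φ, ψ) satisfies the brace conditions. Then at least one of the following holds: (1.1) φ ∈ {E, −E} and ψ ∈ {E, −E}; (1.2) there exist integers p, q, m with gcd(p, q) = 1 such that φ = [[1+mp²q, mpq²], [−mp³, 1−mp²q]] and ψ = [[1+mpq², mq³], [−mp²q, 1−mpq²]]; (1.3) φ = E, det ψ = 1, tr ψ = −1, and ψ₁₁ ≡ 1, ψ₂₁ ≡ 0, ψ₂₂ ≡ 1 (mod 3); (1.4) ψ = E, det φ = 1, tr φ = −1, and φ₁₁ ≡ 1, φ₁₂ ≡ 0, φ₂₂ ≡ 1 (mod 3); (1.5) ψ = φ, det φ = 1, tr φ = −1, and φ is congruent modulo 3 to one of [[0,2],[1,2]], [[2,1],[2,0]], [[1,0],[0,1]]; (1.6) ψ = φ⁻¹, det φ = 1, tr φ = −1, and φ is congruent modulo 3 to one of [[0,1],[2,2]], [[2,2],[1,0]], [[1,0],[0,1]]; (2.1) φ = E, det ψ = −1, tr ψ = 0, and ψ₁₁ ≡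 1, ψ₂₁ ≡ 0, ψ₂₂ ≡ 1 (mod 2); (2.2) φ = −E, det ψ = −1, tr ψ = 0, and ψ ≡ E (mod 2); (3.1) ψ = E, det φ = −1, tr φ = 0, and φ₁₁ ≡ 1, φ₁₂ ≡ 0, φ₂₂ ≡ 1 (mod 2); (3.2) ψ = −E, det φ = −1, tr φ = 0, and φ ≡ E (mod 2); (4.1) ψ = φ, det φ = −1, tr φ = 0, and φ is congruent modulo 2 to E or to [[0,1],[1,0]]; (4.2) ψ = −φ, det φ = −1, tr φ = 0, and φ ≡ E (mod 2). -/
/-- 2×2 integer matrices. -/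
abbrev M2 := Matrix (Fin 2) (Fin 2) ℤ

/-- The pair `(φ, ψ)` of elements of `GL₂(ℤ)` satisfies the brace conditions:
`φψ = ψφ` and the four equalities
`φ^(φ₁₁−1)·ψ^(φ₂₁) = E`, `φ^(φ₁₂)·ψ^(φ₂₂−1) = E`,
`φ^(ψ₁₁−1)·ψ^(ψ₂₁) = E`, `φ^(ψ₁₂)·ψ^(ψ₂₂−1) = E`,
where powers with integer exponents are taken in the group `GL₂(ℤ)`. -/
def BraceCond (φ ψ : GL (Fin 2) ℤ) : Prop :=
  φ * ψ = ψ * φ ∧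
  φ ^ ((φ : M2) 0 0 - 1) * ψ ^ ((φ : M2) 1 0) = 1 ∧
  φ ^ ((φ : M2) 0 1) * ψ ^ ((φ : M2) 1 1 - 1) = 1 ∧
  φ ^ ((ψ : M2) 0 0 - 1) * ψ ^ ((ψ : M2) 1 0) = 1 ∧
  φ ^ ((ψ : M2) 0 1) * ψ ^ ((ψ : M2) 1 1 - 1) = 1

/-- Entrywise congruence of integer matrices modulo `k`. -/
def MatModEq (k : ℤ) (A B : M2) : Prop := ∀ i j, A i j ≡ B i j [ZMOD k]

namespace LambdaBrace

open Matrix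

theorem ext_entries {A B : M2} (h₁ : A 0 0 = B 0 0) (h₂ : A 0 1 = B 0 1) (h₃ : A 1 0 = B 1 0)
    (h₄ : A 1 1 = B 1 1) : A = B := by
  ext i j
  fin_cases i <;> fin_cases j <;> assumption

theorem matModEq_iff {k : ℤ} {A B : M2} : MatModEq k A B ↔
    (A 0 0 ≡ B 0 0 [ZMOD k] ∧ A 0 1 ≡ B 0 1 [ZMOD k]) ∧
      A 1 0 ≡ B 1 0 [ZMOD k] ∧ A 1 1 ≡ B 1 1 [ZMOD k] := by
  simp only [MatModEq, Fin.forall_fin_two]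

theorem mul_self_eq (A : M2) : A * A = A.trace • A - A.det • (1 : M2) := by
  rw [det_fin_two, trace_fin_two]
  apply ext_entries <;> simp only [mul_apply, Fin.sum_univ_two, Matrix.sub_apply,
    Matrix.smul_apply, smul_eq_mul] <;> simp <;> ring

theorem eq_one_or_neg_one_of_smul_eq {A : M2} (hA : A.det = 1) {k l : ℤ} (hk : k ≠ 0)
    (h : k • A = l • (1 : M2)) : A = 1 ∨ A = -1 := by
  have h₁ := congrFun₂ h 0 0
  have h₂ := congrFun₂ h 0 1
  have h₃ := congrFun₂ h 1 0
  have h₄ := congrFun₂ h 1 1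
  simp [hk] at h₁ h₂ h₃ h₄
  have had : A 0 0 = A 1 1 := mul_left_cancel₀ hk (h₁.trans h₄.symm)
  rw [det_fin_two, h₂, had] at hA
  have : A 1 1 * A 1 1 = 1 := by linarith
  rcases mul_self_eq_one_iff.mp this with h | h
  · left; apply ext_entries <;> simp [*]
  · right; apply ext_entries <;> simp [*]

/-- If `A` has determinant one and `2 ≤ |tr A|`, the coefficients of the powers of `A` in the
basis `A, 1` grow. -/
theorem exists_pow_succ_eq {A : M2} (hA : A.det = 1) (ht : 2 ≤ |A.trace|) (n : ℕ) :
    ∃ u v : ℤ, A ^ (n + 1) = u • A - v • (1 : M2) ∧ |v| < |u| := by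
  induction n with
  | zero => exact ⟨1, 0, by simp, by simp⟩
  | succ n ih =>
    obtain ⟨u, v, h, huv⟩ := ih
    refine ⟨u * A.trace - v, u, ?_, ?_⟩
    · rw [pow_succ, h, sub_mul, smul_mul_assoc, smul_mul_assoc, mul_self_eq, hA, one_mul]
      module
    · have h₁ := abs_sub_abs_le_abs_sub (u * A.trace) v
      rw [abs_mul] at h₁
      nlinarith [abs_nonneg u]

theorem eq_one_or_neg_one_of_pow_eq_one {A : M2} (hA : A.det = 1) (ht : 2 ≤ |A.trace|) {n : ℕ}
    (hn : 0 < n) (h : A ^ n = 1) : A = 1 ∨ A = -1 := by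
  obtain ⟨k, rfl⟩ : ∃ k, n = k + 1 := ⟨n - 1, by omega⟩
  obtain ⟨u, v, h', huv⟩ := exists_pow_succ_eq hA ht k
  refine eq_one_or_neg_one_of_smul_eq (k := u) (l := v + 1) hA ?_ ?_
  · rintro rfl
    simp at huv
    linarith [abs_nonneg v]
  · rw [h', sub_eq_iff_eq_add] at h
    rw [h]
    module

theorem trace_eq_zero_of_pow_eq_one {A : M2} (hA : A.det = -1) {n : ℕ}
    (hn : 0 < n) (h : A ^ n = 1) : A.trace = 0 := by
  have htr : (A * A).trace = A.trace ^ 2 + 2 := by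
    rw [mul_self_eq, hA]; simp [-zsmul_eq_mul]; ring
  have hsq : A * A = 1 ∨ A * A = -1 := by
    refine eq_one_or_neg_one_of_pow_eq_one (n := n) (by simp [hA]) ?_ hn ?_
    · rw [htr, abs_of_nonneg (by positivity)]; nlinarith
    · rw [← pow_two, ← pow_mul, mul_comm, pow_mul, h, one_pow]
  rcases hsq with h | h <;> rw [h] at htr <;> simp at htr <;> nlinarith

theorem eq_one_or_neg_one_of_mul_self_eq_one {A : M2} (hA : A.det = 1) (h : A * A = 1) :
    A = 1 ∨ A = -1 := by
  rw [mul_self_eq, hA, one_smul, sub_eq_iff_eq_add] at h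
  refine eq_one_or_neg_one_of_smul_eq (k := A.trace) (l := 2) hA (fun h0 => ?_) (by rw [h]; module)
  have := congrFun₂ h 0 0
  simp [h0] at this

theorem eq_one_or_trace_of_pow_three {A : M2} (h : A ^ 3 = 1) :
    A = 1 ∨ A.det = 1 ∧ A.trace = -1 := by
  have hd : A.det = 1 := by
    have := congrArg det h
    rw [det_pow, det_one] at this
    rcases Int.isUnit_iff.mp (IsUnit.of_pow_eq_one this three_ne_zero) with h | h <;> simp_all
  have h₁ : (A.trace + 1) • (A.trace - 1) • A = (A.trace + 1) • (1 : M2) := by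
    rw [pow_succ, pow_two, mul_self_eq, sub_mul, smul_mul_assoc, mul_self_eq, hd] at h
    simp only [one_smul, one_mul] at h
    rw [← sub_eq_zero] at h ⊢
    rw [← h]
    module
  by_cases ht : A.trace = -1
  · exact .inr ⟨hd, ht⟩
  left
  have ht' : A.trace + 1 ≠ 0 := by omega
  have h₂ : (A.trace - 1) • A = 1 := smul_right_injective _ ht' h₁
  have h₃ : A.trace - 1 ≠ 0 := by
    intro h0
    simp [h0] at h₂
  rcases eq_one_or_neg_one_of_smul_eq (l := 1) hd h₃ (by simpa using h₂) with h | h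
  · exact h
  · subst h
    have := congrFun₂ h₂ 0 0
    simp at this

theorem commute_entries {A B : M2} (h : A * B = B * A) :
    A 0 1 * B 1 0 = B 0 1 * A 1 0 ∧ (A 0 0 - A 1 1) * B 0 1 = A 0 1 * (B 0 0 - B 1 1) ∧
      A 1 0 * (B 0 0 - B 1 1) = B 1 0 * (A 0 0 - A 1 1) := by
  have h₁ := congrFun₂ h 0 0
  have h₂ := congrFun₂ h 0 1
  have h₃ := congrFun₂ h 1 0
  simp [mul_apply] at h₁ h₂ h₃
  refine ⟨?_, ?_, ?_⟩ <;> linarith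

/-- The centralizer of a matrix with characteristic polynomial `X² + X + 1` is anisotropic. -/
theorem eq_zero_of_commute_of_det_eq_zero {A X : M2} (hd : A.det = 1) (ht : A.trace = -1)
    (h : A * X = X * A) (hX : X.det = 0) : X = 0 := by
  obtain ⟨h₁, h₂, h₃⟩ := commute_entries h
  rw [det_fin_two] at hd hX
  rw [trace_fin_two] at ht
  have hb : A 0 1 ≠ 0 := by
    intro hb
    rw [hb] at hd
    nlinarith [sq_nonneg (A 0 0 - A 1 1)]
  have key : (2 * A 0 1 * X 1 1 + (A 0 0 - A 1 1) * X 0 1) ^ 2 + 3 * X 0 1 ^ 2 = 0 := by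
    have hdisc : (A 0 0 - A 1 1) ^ 2 + 4 * (A 0 1 * A 1 0) = -3 := by
      linear_combination (A 0 0 + A 1 1 - 1) * ht - 4 * hd
    linear_combination 4 * A 0 1 ^ 2 * hX + 4 * A 0 1 * X 0 1 * h₁ + 4 * A 0 1 * X 1 1 * h₂ +
      X 0 1 ^ 2 * hdisc
  have hq : X 0 1 = 0 := by
    have : X 0 1 ^ 2 = 0 := by
      nlinarith [sq_nonneg (2 * A 0 1 * X 1 1 + (A 0 0 - A 1 1) * X 0 1), sq_nonneg (X 0 1)]
    exact pow_eq_zero_iff two_ne_zero |>.mp this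
  have hs : X 1 1 = 0 := by simpa [hq, hb] using key
  have hp : X 0 0 = 0 := by simpa [hq, hs, hb] using h₂
  have hr : X 1 0 = 0 := by simpa [hq, hb] using h₁
  apply ext_entries <;> simpa

theorem eq_or_mul_eq_one_of_trace {A B : M2} (hA : A.det = 1) (tA : A.trace = -1)
    (hB : B.det = 1) (tB : B.trace = -1) (h : A * B = B * A) : B = A ∨ A * B = 1 := by
  have hBB := mul_self_eq B
  have hAA := mul_self_eq A
  rw [hA, tA] at hAA
  rw [hB, tB] at hBB
  have hprod : (B - A) * (A * B - 1) = 0 := by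
    have : (B - A) * (A * B - 1) = A * (B * B) - A * A * B - B + A := by
      have : B * (A * B) = A * (B * B) := by rw [← mul_assoc, ← h, mul_assoc]
      rw [sub_mul, mul_sub, mul_sub, this, mul_one, mul_one, mul_assoc]
      abel
    rw [this, hAA, hBB]
    simp [sub_mul, mul_sub, h]
  have hdet := congrArg det hprod
  rw [det_mul, det_zero, mul_eq_zero] at hdet
  rcases hdet with h0 | h0
  · left
    exact sub_eq_zero.mp (eq_zero_of_commute_of_det_eq_zero hA tA (by rw [mul_sub, sub_mul, h]) h0)
  · right
    refine sub_eq_zero.mp (eq_zero_of_commute_of_det_eq_zero hA tA ?_ h0)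
    rw [mul_sub, sub_mul, mul_assoc, ← h, mul_one, one_mul]

/-- A unipotent matrix commuting with a reflection is trivial. -/
theorem eq_one_of_commute_reflection {A B : M2} (hA : A.det = -1) (tA : A.trace = 0)
    (hB : B.det = 1) (tB : B.trace = 2) (h : A * B = B * A) : B = 1 := by
  obtain ⟨h₁, h₂, h₃⟩ := commute_entries h
  rw [det_fin_two] at hA hB
  rw [trace_fin_two] at tA tB
  obtain ⟨p, hp⟩ : ∃ p, B 0 0 = 1 + p := ⟨B 0 0 - 1, by ring⟩
  have hd : A 1 1 = -A 0 0 := by linarith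
  have hp' : B 1 1 = 1 - p := by linarith
  rw [hd] at hA h₂ h₃
  rw [hp, hp'] at hB h₂ h₃
  generalize A 0 0 = a at hA h₂ h₃
  generalize A 0 1 = b at hA h₁ h₂
  generalize A 1 0 = c at hA h₁ h₃
  generalize hq : B 0 1 = q at hB h₁ h₂
  generalize hr : B 1 0 = r at hB h₁ h₃
  have e₂ : a * q = b * p := by linarith
  have e₃ : c * p = r * a := by linarith
  have p0 : p = 0 := by
    have : p ^ 2 = 0 := by
      linear_combination p ^ 2 * hA - a ^ 2 * hB + b * p * e₃ - a * r * e₂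
    exact pow_eq_zero_iff two_ne_zero |>.mp this
  subst p0
  have q0 : q = 0 := by
    have : q ^ 2 = 0 := by
      linear_combination q ^ 2 * hA - b ^ 2 * hB + a * q * e₂ - b * q * h₁
    exact pow_eq_zero_iff two_ne_zero |>.mp this
  have r0 : r = 0 := by
    have : r ^ 2 = 0 := by
      linear_combination r ^ 2 * hA - a * r * e₃ + r * c * h₁ - c ^ 2 * hB
    exact pow_eq_zero_iff two_ne_zero |>.mp this
  apply ext_entries <;> simp [*]

theorem mul_eq_zero_of_commute_nilpotent {N M : M2} (hN : N.det = 0) (tN : N.trace = 0)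
    (hM : M.det = 0) (tM : M.trace = 0) (h : N * M = M * N) : N * M = 0 := by
  obtain ⟨h₁, h₂, h₃⟩ := commute_entries h
  rw [det_fin_two] at hN hM
  rw [trace_fin_two] at tN tM
  have hd : N 1 1 = -N 0 0 := by linarith
  have hd' : M 1 1 = -M 0 0 := by linarith
  rw [hd] at hN h₂ h₃
  rw [hd'] at hM h₂ h₃
  have e₂ : N 0 0 * M 0 1 = N 0 1 * M 0 0 := by linarith
  have e₃ : N 1 0 * M 0 0 = M 1 0 * N 0 0 := by linarith
  have t0 : N 0 0 * M 0 0 + N 0 1 * M 1 0 = 0 := by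
    have : (N 0 0 * M 0 0 + N 0 1 * M 1 0) ^ 2 = 0 := by
      linear_combination (-M 0 0 ^ 2) * hN + N 0 1 * N 1 0 * hM
        - 2 * N 0 0 * M 1 0 * e₂ - 2 * M 0 1 * M 1 0 * hN + N 0 1 * M 1 0 * h₁
    exact pow_eq_zero_iff two_ne_zero |>.mp this
  apply ext_entries <;> simp [mul_apply, hd, hd'] <;> linarith

theorem exists_eq_smul_of_smul_add_eq_zero {N M : M2} {u v : ℤ} (huv : u ≠ 0 ∨ v ≠ 0)
    (h : u • N + v • M = 0) : ∃ (p q : ℤ) (L : M2), IsCoprime p q ∧ N = p • L ∧ M = q • L := by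
  obtain ⟨u', v', hc, hu, hv⟩ := Int.exists_gcd_one (Int.gcd_pos_iff.mpr huv)
  have hg : (Int.gcd u v : ℤ) ≠ 0 := by
    intro h0
    rw [h0, mul_zero] at hu hv
    simp [hu, hv] at huv
  have hc' : IsCoprime u' v' := Int.isCoprime_iff_gcd_eq_one.mpr hc
  have h' : u' • N + v' • M = 0 := by
    refine smul_right_injective _ hg ?_
    simp only [smul_add, smul_smul, smul_zero]
    rw [mul_comm _ u', mul_comm _ v', ← hu, ← hv, h]
  obtain ⟨x, y, hxy⟩ := hc'
  refine ⟨v', -u', y • N - x • M, ⟨y, -x, by linear_combination hxy⟩, ?_, ?_⟩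
  · have : (x * u' + y * v') • N = v' • (y • N - x • M) + x • (u' • N + v' • M) := by module
    rwa [hxy, h', one_smul, smul_zero, add_zero] at this
  · have : (x * u' + y * v') • M = -u' • (y • N - x • M) + y • (u' • N + v' • M) := by module
    rwa [hxy, h', one_smul, smul_zero, add_zero] at this

theorem exists_parametrization {N M : M2} (tN : N.trace = 0) (tM : M.trace = 0)
    (h₁ : N 0 0 • N + N 1 0 • M = 0) (h₂ : N 0 1 • N + N 1 1 • M = 0)
    (h₃ : M 0 0 • N + M 1 0 • M = 0) (h₄ : M 0 1 • N + M 1 1 • M = 0) :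
    ∃ p q m : ℤ, Int.gcd p q = 1 ∧
      N = !![m * p ^ 2 * q, m * p * q ^ 2; -(m * p ^ 3), -(m * p ^ 2 * q)] ∧
      M = !![m * p * q ^ 2, m * q ^ 3; -(m * p ^ 2 * q), -(m * p * q ^ 2)] := by
  by_cases h0 : N = 0 ∧ M = 0
  · refine ⟨1, 0, 0, by simp, ?_, ?_⟩
    · rw [h0.1]; apply ext_entries <;> simp
    · rw [h0.2]; apply ext_entries <;> simp
  obtain ⟨p, q, L, hc, rfl, rfl⟩ :
      ∃ (p q : ℤ) (L : M2), IsCoprime p q ∧ N = p • L ∧ M = q • L := by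
    by_contra hne
    have key (u v : ℤ) (h : u • N + v • M = 0) : u = 0 ∧ v = 0 := by
      by_contra huv
      exact hne (exists_eq_smul_of_smul_add_eq_zero (by tauto) h)
    refine h0 ⟨?_, ?_⟩
    · apply ext_entries <;> simp [key _ _ h₁, key _ _ h₂]
    · apply ext_entries <;> simp [key _ _ h₃, key _ _ h₄]
  have hL : L ≠ 0 := by rintro rfl; simp at h0
  have tL : L 1 1 = -L 0 0 := by
    rw [trace_smul, smul_eq_mul] at tN tM
    have : L.trace = 0 := by
      obtain ⟨x, y, hxy⟩ := hc
      linear_combination x * tN + y * tM - L.trace * hxy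
    rw [trace_fin_two] at this
    linarith
  have cancel (u v : ℤ) (h : u • p • L + v • q • L = 0) : u * p + v * q = 0 := by
    rw [smul_smul, smul_smul, ← add_smul, smul_eq_zero] at h
    exact h.resolve_right hL
  have e₁ := cancel _ _ h₁
  have e₂ := cancel _ _ h₂
  have e₃ := cancel _ _ h₃
  have e₄ := cancel _ _ h₄
  simp only [Matrix.smul_apply, smul_eq_mul, tL] at e₁ e₂ e₃ e₄
  have hgcd := Int.isCoprime_iff_gcd_eq_one.mp hc
  generalize hl : L 0 0 = l at *
  generalize hk : L 0 1 = k at *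
  generalize hr : L 1 0 = r at *
  have f₁ : l * p = -(r * q) := by
    obtain ⟨x, y, hxy⟩ := hc
    linear_combination x * e₁ + y * e₃ - (l * p + r * q) * hxy
  have f₂ : k * p = l * q := by
    obtain ⟨x, y, hxy⟩ := hc
    linear_combination x * e₂ + y * e₄ - (k * p - l * q) * hxy
  obtain ⟨m, hlm, hkm, hrm⟩ : ∃ m, l = m * p * q ∧ k = m * q ^ 2 ∧ r = -(m * p ^ 2) := by
    have sq_eq_one {n : ℤ} (hn : IsUnit n) : n ^ 2 = 1 := by
      rcases Int.isUnit_iff.mp hn with h | h <;> simp [h]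
    by_cases hp : p = 0
    · subst hp
      have hq : IsUnit q := isCoprime_zero_left.mp hc
      refine ⟨k, ?_, by rw [sq_eq_one hq, mul_one], ?_⟩
      · simpa [hq.ne_zero] using f₂
      · simpa [hq.ne_zero] using f₁
    by_cases hq : q = 0
    · subst hq
      have hp' : IsUnit p := isCoprime_zero_right.mp hc
      refine ⟨-r, ?_, ?_, by rw [sq_eq_one hp']; ring⟩
      · simpa [hp] using f₁
      · simpa [hp] using f₂
    obtain ⟨s, rfl⟩ : q ∣ l := hc.symm.dvd_of_dvd_mul_right ⟨-r, by linarith⟩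
    obtain ⟨m, rfl⟩ : p ∣ s := (hc.pow_right (n := 2)).dvd_of_dvd_mul_right ⟨k, by linarith⟩
    exact ⟨m, by ring, mul_right_cancel₀ hp (by linarith), mul_right_cancel₀ hq (by linarith)⟩
  refine ⟨p, q, m, hgcd, ?_, ?_⟩
  · apply ext_entries <;> simp [*, -zsmul_eq_mul] <;> ring
  · apply ext_entries <;> simp [*, -zsmul_eq_mul] <;> ring

theorem zpow_det_eq_one {G : Type*} [Group G] {g h : G} (c : Commute g h) {x y z w : ℤ}
    (h₁ : g ^ x * h ^ y = 1) (h₂ : g ^ z * h ^ w = 1) :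
    g ^ (x * w - y * z) = 1 ∧ h ^ (x * w - y * z) = 1 := by
  have key (k l : ℤ) : g ^ (x * k + z * l) * h ^ (y * k + w * l) = 1 := by
    have e₁ : g ^ (x * k) * h ^ (y * k) = 1 := by
      rw [_root_.zpow_mul, _root_.zpow_mul, ← (c.zpow_zpow x y).mul_zpow, h₁, _root_.one_zpow]
    have e₂ : g ^ (z * l) * h ^ (w * l) = 1 := by
      rw [_root_.zpow_mul, _root_.zpow_mul, ← (c.zpow_zpow z w).mul_zpow, h₂, _root_.one_zpow]
    rw [_root_.zpow_add, _root_.zpow_add, mul_assoc, ← mul_assoc (g ^ (z * l)), (c.zpow_zpow _ _).eq,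
      mul_assoc, e₂, mul_one, e₁]
  constructor
  · have := key w (-y)
    rwa [show y * w + w * -y = 0 by ring, zpow_zero, mul_one,
      show x * w + z * -y = x * w - y * z by ring] at this
  · have := key (-z) x
    rwa [show x * -z + z * x = 0 by ring, zpow_zero, one_mul,
      show y * -z + w * x = x * w - y * z by ring] at this

theorem prime_dvd_of_zpow_eq_one {G : Type*} [Group G] {g : G} {p : ℕ} (hp : p.Prime)
    (hg : g ^ p = 1) (h1 : g ≠ 1) {x : ℤ} (hx : g ^ x = 1) : (p : ℤ) ∣ x := by
  have := Fact.mk hp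
  rwa [← orderOf_eq_prime hg h1, orderOf_dvd_iff_zpow_eq_one]

theorem det_eq_one_or (g : GL (Fin 2) ℤ) : (g : M2).det = 1 ∨ (g : M2).det = -1 :=
  Int.isUnit_iff.mp ((isUnit_iff_isUnit_det _).mp g.isUnit)

theorem val_eq_one_iff {g : GL (Fin 2) ℤ} : (g : M2) = 1 ↔ g = 1 :=
  ⟨fun h => Units.ext h, fun h => by rw [h, Units.val_one]⟩

theorem val_eq_neg_one_iff {g : GL (Fin 2) ℤ} : (g : M2) = -1 ↔ g = -1 := by
  rw [← Units.val_inj, Units.val_neg, Units.val_one]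

theorem neg_one_ne_one : (-1 : GL (Fin 2) ℤ) ≠ 1 := by
  intro h
  have h' : (-1 : M2) = 1 := by simpa using congrArg (fun g : GL (Fin 2) ℤ => (g : M2)) h
  have := congrFun₂ h' 0 0
  simp at this

theorem coe_zpow_of_unipotent {g : GL (Fin 2) ℤ} (hg : ((g : M2) - 1) * ((g : M2) - 1) = 0)
    (n : ℤ) : ((g ^ n : GL (Fin 2) ℤ) : M2) = 1 + n • ((g : M2) - 1) := by
  have hinv : ((g⁻¹ : GL (Fin 2) ℤ) : M2) = 1 - ((g : M2) - 1) := by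
    rw [Units.inv_eq_of_mul_eq_one_right]
    rw [show (g : M2) * (1 - ((g : M2) - 1)) =
      1 - ((g : M2) - 1) * ((g : M2) - 1) by noncomm_ring, hg, sub_zero]
  have hval : (g : M2) = 1 + ((g : M2) - 1) := by abel
  generalize (g : M2) - 1 = N at *
  induction n using Int.induction_on with
  | zero => simp
  | succ n ih =>
    rw [_root_.zpow_add_one, Units.val_mul, ih, hval, add_mul, mul_add, smul_mul_assoc, mul_add, hg]
    simp only [one_mul, mul_one, add_zero]
    module
  | pred n ih =>
    rw [_root_.zpow_sub_one, Units.val_mul, ih, hinv, add_mul, mul_sub, smul_mul_assoc, mul_sub, hg]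
    simp only [one_mul, mul_one, sub_zero]
    module

theorem sub_one_nilpotent {A : M2} (hd : A.det = 1) (ht : A.trace = 2) :
    (A - 1).det = 0 ∧ (A - 1).trace = 0 ∧ (A - 1) * (A - 1) = 0 := by
  have h₁ : (A - 1).trace = 0 := by simp [ht]
  have h₂ : (A - 1).det = 0 := by
    rw [det_fin_two] at hd ⊢
    rw [trace_fin_two] at ht
    simp
    linarith
  exact ⟨h₂, h₁, by rw [mul_self_eq, h₁, h₂]; simp⟩

/-- The determinant of `g - 1`, where nonzero, is an exponent of a finite-order element `g`. -/
theorem trace_det_cases {g : GL (Fin 2) ℤ} {D : ℤ} (hD : D = 1 - (g : M2).trace + (g : M2).det)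
    (hg : g ^ D = 1) :
    ((g : M2).det = 1 ∧ (g : M2).trace = 2) ∨ ((g : M2).det = -1 ∧ (g : M2).trace = 0) ∨
      g = -1 ∨ ((g : M2).det = 1 ∧ (g : M2).trace = -1 ∧ D = 3) := by
  by_cases h0 : D = 0
  · rcases det_eq_one_or g with h | h
    · exact .inl ⟨h, by linarith⟩
    · exact .inr (.inl ⟨h, by linarith⟩)
  obtain ⟨n, hn, hgn⟩ := isOfFinOrder_iff_pow_eq_one.mp
    (isOfFinOrder_iff_zpow_eq_one.mpr ⟨D, h0, hg⟩)
  have hgn' : (g : M2) ^ n = 1 := by rw [← Units.val_pow_eq_pow_val, hgn, Units.val_one]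
  rcases det_eq_one_or g with hd | hd
  swap
  · exact .inr (.inl ⟨hd, trace_eq_zero_of_pow_eq_one hd hn hgn'⟩)
  by_cases ht : 2 ≤ |(g : M2).trace|
  · rcases eq_one_or_neg_one_of_pow_eq_one hd ht hn hgn' with h | h
    · left; simp [h]
    · exact .inr (.inr (.inl (val_eq_neg_one_iff.mp h)))
  rw [not_le, abs_lt] at ht
  obtain ht | ht | ht : (g : M2).trace = -1 ∨ (g : M2).trace = 0 ∨ (g : M2).trace = 1 := by omega
  · exact .inr (.inr (.inr ⟨hd, ht, by rw [hD, hd, ht]; norm_num⟩))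
  · have h2 : g ^ (2 : ℕ) = 1 := by
      rw [hD, hd, ht] at hg
      exact_mod_cast hg
    have hsq : (g : M2) * (g : M2) = 1 := by
      rw [← Units.val_mul, ← pow_two, h2, Units.val_one]
    rw [mul_self_eq, hd, ht] at hsq
    have := congrFun₂ hsq 0 0
    simp at this
  · have h1 : g = 1 := by
      rw [hD, hd, ht] at hg
      simpa using hg
    simp [h1] at ht

theorem sq_eq_one_of_reflection {g : GL (Fin 2) ℤ} (hd : (g : M2).det = -1)
    (ht : (g : M2).trace = 0) : g ^ 2 = 1 := by
  rw [pow_two, ← val_eq_one_iff, Units.val_mul, mul_self_eq, hd, ht]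
  simp

theorem zpow_eq_one_or_self {G : Type*} [Group G] {g : G} (hg : g ^ 2 = 1) (n : ℤ) :
    Even n ∧ g ^ n = 1 ∨ Odd n ∧ g ^ n = g := by
  have hg' : g ^ (2 : ℤ) = 1 := by exact_mod_cast hg
  rcases Int.even_or_odd' n with ⟨k, rfl | rfl⟩
  · left; simp [_root_.zpow_mul, hg']
  · right; simp [_root_.zpow_add, _root_.zpow_mul, hg']

theorem even_of_neg_one_zpow_mul {g : GL (Fin 2) ℤ} (hg : g ^ 2 = 1) (h1 : g ≠ 1) (h2 : g ≠ -1)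
    {x y : ℤ} (h : (-1 : GL (Fin 2) ℤ) ^ x * g ^ y = 1) : Even x ∧ Even y := by
  rcases zpow_eq_one_or_self (g := (-1 : GL (Fin 2) ℤ)) (by simp) x with ⟨hx, ex⟩ | ⟨hx, ex⟩ <;>
  rcases zpow_eq_one_or_self hg y with ⟨hy, ey⟩ | ⟨hy, ey⟩ <;> rw [ex, ey] at h
  · exact ⟨hx, hy⟩
  · simp [h1] at h
  · simp [neg_one_ne_one] at h
  · rw [neg_one_mul, neg_eq_iff_eq_neg] at h
    exact absurd h h2

theorem reflection_ne {g : GL (Fin 2) ℤ} (hd : (g : M2).det = -1) : g ≠ 1 ∧ g ≠ -1 := by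
  constructor <;> rintro rfl <;> simp [det_neg] at hd

theorem commute_coe {φ ψ : GL (Fin 2) ℤ} (h : φ * ψ = ψ * φ) : (φ : M2) * ψ = ψ * φ := by
  rw [← Units.val_mul, h, Units.val_mul]

theorem unipotent_of_braceCond {φ ψ : GL (Fin 2) ℤ} (h : BraceCond φ ψ)
    (dφ : (φ : M2).det = 1) (tφ : (φ : M2).trace = 2)
    (dψ : (ψ : M2).det = 1) (tψ : (ψ : M2).trace = 2) :
    ∃ p q m : ℤ, Int.gcd p q = 1 ∧
      (φ : M2) = !![1 + m * p ^ 2 * q, m * p * q ^ 2; -(m * p ^ 3), 1 - m * p ^ 2 * q] ∧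
      (ψ : M2) = !![1 + m * p * q ^ 2, m * q ^ 3; -(m * p ^ 2 * q), 1 - m * p * q ^ 2] := by
  obtain ⟨hc, h₁, h₂, h₃, h₄⟩ := h
  have hc' := commute_coe hc
  obtain ⟨dN, tN, sN⟩ := sub_one_nilpotent dφ tφ
  obtain ⟨dM, tM, sM⟩ := sub_one_nilpotent dψ tψ
  have hNM : ((φ : M2) - 1) * ((ψ : M2) - 1) = 0 :=
    mul_eq_zero_of_commute_nilpotent dN tN dM tM (by
      simp only [sub_mul, mul_sub, hc', mul_one, one_mul]; abel)
  have linearize {x y : ℤ} (h : φ ^ x * ψ ^ y = 1) :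
      x • ((φ : M2) - 1) + y • ((ψ : M2) - 1) = 0 := by
    have h' := congrArg (fun g : GL (Fin 2) ℤ => (g : M2)) h
    simp only [Units.val_mul, coe_zpow_of_unipotent sN, coe_zpow_of_unipotent sM,
      Units.val_one] at h'
    generalize (φ : M2) - 1 = N at *
    generalize (ψ : M2) - 1 = M at *
    rw [add_mul, mul_add, one_mul, one_mul, mul_add, smul_mul_smul_comm, hNM, mul_one, smul_zero,
      add_zero] at h'
    rw [← sub_eq_zero] at h'
    rw [← h']
    abel
  obtain ⟨p, q, m, hpq, hN, hM⟩ := exists_parametrization tN tM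
    (by simpa [-zsmul_eq_mul] using linearize h₁) (by simpa [-zsmul_eq_mul] using linearize h₂)
    (by simpa [-zsmul_eq_mul] using linearize h₃) (by simpa [-zsmul_eq_mul] using linearize h₄)
  rw [sub_eq_iff_eq_add] at hN hM
  refine ⟨p, q, m, hpq, ?_, ?_⟩
  · rw [hN]
    apply ext_entries <;> simp <;> ring
  · rw [hM]
    apply ext_entries <;> simp <;> ring

theorem coe_pow_three {g : GL (Fin 2) ℤ} (h : g ^ 3 = 1) : (g : M2) ^ 3 = 1 := by
  rw [← Units.val_pow_eq_pow_val, h, Units.val_one]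

theorem reflections_of_braceCond {φ ψ : GL (Fin 2) ℤ} (h : BraceCond φ ψ)
    (dφ : (φ : M2).det = -1) (tφ : (φ : M2).trace = 0)
    (dψ : (ψ : M2).det = -1) (tψ : (ψ : M2).trace = 0) :
    (ψ = φ ∧ (MatModEq 2 (φ : M2) 1 ∨ MatModEq 2 (φ : M2) !![0, 1; 1, 0])) ∨
      ((ψ : M2) = -(φ : M2) ∧ MatModEq 2 (φ : M2) 1) := by
  obtain ⟨hc, h₁, h₂, -, -⟩ := h
  have s := sq_eq_one_of_reflection dφ tφ
  have sψ := sq_eq_one_of_reflection dψ tψ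
  obtain ⟨n1, n2⟩ := reflection_ne dφ
  have hprod : (φ * ψ) * (φ * ψ) = 1 := by
    rw [← pow_two, (show Commute φ ψ from hc).mul_pow, s, sψ, one_mul]
  have hinv : φ⁻¹ = φ := inv_eq_of_mul_eq_one_right (by rw [← pow_two, s])
  have htr : (φ : M2) 1 1 = -(φ : M2) 0 0 := by rw [trace_fin_two] at tφ; linarith
  rcases eq_one_or_neg_one_of_mul_self_eq_one (A := ((φ * ψ : GL (Fin 2) ℤ) : M2))
    (by rw [Units.val_mul, det_mul, dφ, dψ]; norm_num)
    (by rw [← Units.val_mul, hprod, Units.val_one]) with h | h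
  · left
    have hψ : ψ = φ := by
      rw [val_eq_one_iff] at h
      rw [← hinv, eq_inv_of_mul_eq_one_right h]
    subst hψ
    refine ⟨rfl, ?_⟩
    rw [← _root_.zpow_add] at h₁ h₂
    have e₁ := prime_dvd_of_zpow_eq_one Nat.prime_two s n1 h₁
    have e₂ := prime_dvd_of_zpow_eq_one Nat.prime_two s n1 h₂
    push_cast at e₁ e₂
    simp [matModEq_iff, Int.ModEq]
    omega
  · right
    have hψ : ψ = -φ := by
      rw [val_eq_neg_one_iff] at h
      rw [← inv_mul_cancel_left φ ψ, h, hinv, mul_neg_one]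
    subst hψ
    refine ⟨by simp, ?_⟩
    have key {x y : ℤ} (h : φ ^ x * (-φ) ^ y = 1) : Even y ∧ Even (x + y) := by
      refine even_of_neg_one_zpow_mul s n1 n2 ?_
      rw [neg_eq_neg_one_mul, (Commute.neg_one_left φ).mul_zpow, ← mul_assoc,
        ((Commute.neg_one_right φ).zpow_zpow x y).eq, mul_assoc, ← _root_.zpow_add] at h
      exact h
    have e₁ := key h₁
    have e₂ := key h₂
    simp only [Int.even_iff] at e₁ e₂
    simp [matModEq_iff, Int.ModEq]
    omega

theorem order_three_of_braceCond {φ ψ : GL (Fin 2) ℤ} (h : BraceCond φ ψ) (s : φ ^ 3 = 1)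
    (dφ : (φ : M2).det = 1) (tφ : (φ : M2).trace = -1)
    (dψ : (ψ : M2).det = 1) (tψ : (ψ : M2).trace = -1) :
    (ψ = φ ∧ (MatModEq 3 (φ : M2) !![0, 2; 1, 2] ∨ MatModEq 3 (φ : M2) !![2, 1; 2, 0] ∨
        MatModEq 3 (φ : M2) !![1, 0; 0, 1])) ∨
      (ψ = φ⁻¹ ∧ (MatModEq 3 (φ : M2) !![0, 1; 2, 2] ∨ MatModEq 3 (φ : M2) !![2, 2; 1, 0] ∨
        MatModEq 3 (φ : M2) !![1, 0; 0, 1])) := by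
  obtain ⟨hc, h₁, h₂, -, -⟩ := h
  have n1 : φ ≠ 1 := by rintro rfl; simp at tφ
  have htr := tφ
  rw [trace_fin_two] at htr
  rcases eq_or_mul_eq_one_of_trace dφ tφ dψ tψ (commute_coe hc) with h | h
  · left
    obtain rfl := Units.ext h
    rw [← _root_.zpow_add] at h₁ h₂
    have e₁ := prime_dvd_of_zpow_eq_one Nat.prime_three s n1 h₁
    have e₂ := prime_dvd_of_zpow_eq_one Nat.prime_three s n1 h₂
    push_cast at e₁ e₂
    refine ⟨rfl, ?_⟩
    simp [matModEq_iff, Int.ModEq]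
    omega
  · right
    rw [← Units.val_mul, val_eq_one_iff] at h
    obtain rfl := eq_inv_of_mul_eq_one_right h
    rw [_root_.inv_zpow', ← _root_.zpow_add] at h₁ h₂
    have e₁ := prime_dvd_of_zpow_eq_one Nat.prime_three s n1 h₁
    have e₂ := prime_dvd_of_zpow_eq_one Nat.prime_three s n1 h₂
    push_cast at e₁ e₂
    refine ⟨rfl, ?_⟩
    simp [matModEq_iff, Int.ModEq]
    omega

theorem eq_one_or_neg_one_of_sq {g : GL (Fin 2) ℤ} (hd : (g : M2).det = 1) (s : g ^ 2 = 1) :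
    (g : M2) = 1 ∨ (g : M2) = -1 :=
  eq_one_or_neg_one_of_mul_self_eq_one hd (by rw [← Units.val_mul, ← pow_two, s, Units.val_one])

theorem eq_one_of_pow_three {g : GL (Fin 2) ℤ} (s : g ^ 3 = 1) (ht : (g : M2).trace ≠ -1) :
    g = 1 := by
  rcases eq_one_or_trace_of_pow_three (coe_pow_three s) with h | ⟨-, h⟩
  · exact val_eq_one_iff.mp h
  · exact absurd h ht

theorem sq_eq_one_of_zpow_neg_two {G : Type*} [Group G] {g : G} {n : ℤ} (hn : n = -2)
    (h : g ^ n = 1) : g ^ 2 = 1 := by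
  rw [hn, _root_.zpow_neg, inv_eq_one] at h
  exact_mod_cast h

end LambdaBrace

open LambdaBrace

theorem classification_of_lambda_homomorphic_braces_on_Z2
    (φ ψ : GL (Fin 2) ℤ) (h : BraceCond φ ψ) :
    -- 1.1
    ((((φ : M2) = 1 ∨ (φ : M2) = -1) ∧ ((ψ : M2) = 1 ∨ (ψ : M2) = -1))) ∨
    -- 1.2
    ((∃ p q m : ℤ, Int.gcd p q = 1 ∧
      (φ : M2) = !![1 + m * p ^ 2 * q, m * p * q ^ 2; -(m * p ^ 3), 1 - m * p ^ 2 * q] ∧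
      (ψ : M2) = !![1 + m * p * q ^ 2, m * q ^ 3; -(m * p ^ 2 * q), 1 - m * p * q ^ 2])) ∨
    -- 1.3
    (((φ : M2) = 1 ∧ Matrix.det (ψ : M2) = 1 ∧ Matrix.trace (ψ : M2) = -1 ∧
      (ψ : M2) 0 0 ≡ 1 [ZMOD 3] ∧ (ψ : M2) 1 0 ≡ 0 [ZMOD 3] ∧ (ψ : M2) 1 1 ≡ 1 [ZMOD 3])) ∨
    -- 1.4
    (((ψ : M2) = 1 ∧ Matrix.det (φ : M2) = 1 ∧ Matrix.trace (φ : M2) = -1 ∧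
      (φ : M2) 0 0 ≡ 1 [ZMOD 3] ∧ (φ : M2) 0 1 ≡ 0 [ZMOD 3] ∧ (φ : M2) 1 1 ≡ 1 [ZMOD 3])) ∨
    -- 1.5
    ((ψ = φ ∧ Matrix.det (φ : M2) = 1 ∧ Matrix.trace (φ : M2) = -1 ∧
      (MatModEq 3 (φ : M2) !![0, 2; 1, 2] ∨ MatModEq 3 (φ : M2) !![2, 1; 2, 0] ∨
        MatModEq 3 (φ : M2) !![1, 0; 0, 1]))) ∨
    -- 1.6
    ((ψ = φ⁻¹ ∧ Matrix.det (φ : M2) = 1 ∧ Matrix.trace (φ : M2) = -1 ∧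
      (MatModEq 3 (φ : M2) !![0, 1; 2, 2] ∨ MatModEq 3 (φ : M2) !![2, 2; 1, 0] ∨
        MatModEq 3 (φ : M2) !![1, 0; 0, 1]))) ∨
    -- 2.1
    (((φ : M2) = 1 ∧ Matrix.det (ψ : M2) = -1 ∧ Matrix.trace (ψ : M2) = 0 ∧
      (ψ : M2) 0 0 ≡ 1 [ZMOD 2] ∧ (ψ : M2) 1 0 ≡ 0 [ZMOD 2] ∧ (ψ : M2) 1 1 ≡ 1 [ZMOD 2])) ∨
    -- 2.2
    (((φ : M2) = -1 ∧ Matrix.det (ψ : M2) = -1 ∧ Matrix.trace (ψ : M2) = 0 ∧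
      MatModEq 2 (ψ : M2) 1)) ∨
    -- 3.1
    (((ψ : M2) = 1 ∧ Matrix.det (φ : M2) = -1 ∧ Matrix.trace (φ : M2) = 0 ∧
      (φ : M2) 0 0 ≡ 1 [ZMOD 2] ∧ (φ : M2) 0 1 ≡ 0 [ZMOD 2] ∧ (φ : M2) 1 1 ≡ 1 [ZMOD 2])) ∨
    -- 3.2
    (((ψ : M2) = -1 ∧ Matrix.det (φ : M2) = -1 ∧ Matrix.trace (φ : M2) = 0 ∧
      MatModEq 2 (φ : M2) 1)) ∨
    -- 4.1
    ((ψ = φ ∧ Matrix.det (φ : M2) = -1 ∧ Matrix.trace (φ : M2) = 0 ∧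
      (MatModEq 2 (φ : M2) 1 ∨ MatModEq 2 (φ : M2) !![0, 1; 1, 0]))) ∨
    -- 4.2
    (((ψ : M2) = -(φ : M2) ∧ Matrix.det (φ : M2) = -1 ∧ Matrix.trace (φ : M2) = 0 ∧
      MatModEq 2 (φ : M2) 1)) := by
  have hB := h
  obtain ⟨hc, h₁, h₂, h₃, h₄⟩ := h
  have hc' := commute_coe hc
  have hD (A : M2) : (A 0 0 - 1) * (A 1 1 - 1) - A 1 0 * A 0 1 = 1 - A.trace + A.det := by
    rw [Matrix.trace_fin_two, Matrix.det_fin_two]; ring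
  obtain ⟨p₁, p₂⟩ := zpow_det_eq_one hc h₁ h₂
  obtain ⟨p₃, p₄⟩ := zpow_det_eq_one hc h₃ h₄
  rcases trace_det_cases (hD φ) p₁ with ⟨dφ, tφ⟩ | ⟨dφ, tφ⟩ | rfl | ⟨dφ, tφ, hDφ⟩
  · rcases trace_det_cases (hD ψ) p₄ with ⟨dψ, tψ⟩ | ⟨dψ, tψ⟩ | rfl | ⟨dψ, tψ, hDψ⟩
    · exact .inr (.inl (unipotent_of_braceCond hB dφ tφ dψ tψ))
    · iterate 6 right
      left
      have hφ := eq_one_of_commute_reflection dψ tψ dφ tφ hc'.symm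
      refine ⟨hφ, dψ, tψ, ?_⟩
      rw [val_eq_one_iff.mp hφ, one_zpow, one_mul] at h₃ h₄
      have s := sq_eq_one_of_reflection dψ tψ
      have e₃ := prime_dvd_of_zpow_eq_one Nat.prime_two s (reflection_ne dψ).1 h₃
      have e₄ := prime_dvd_of_zpow_eq_one Nat.prime_two s (reflection_ne dψ).1 h₄
      rw [Matrix.trace_fin_two] at tψ
      push_cast at e₃ e₄
      simp only [Int.ModEq]
      omega
    · exact .inl ⟨eq_one_or_neg_one_of_sq dφ (sq_eq_one_of_zpow_neg_two (n := -1 - 1) rfl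
        (by simpa using h₃)), by simp⟩
    · iterate 2 right
      left
      rw [hDψ] at p₃ p₄
      have hφ := eq_one_of_pow_three (by exact_mod_cast p₃) (by rw [tφ]; norm_num)
      have s : ψ ^ 3 = 1 := by exact_mod_cast p₄
      have n1 : ψ ≠ 1 := by rintro rfl; simp at tψ
      refine ⟨val_eq_one_iff.mpr hφ, dψ, tψ, ?_⟩
      rw [hφ, one_zpow, one_mul] at h₃ h₄
      have e₃ := prime_dvd_of_zpow_eq_one Nat.prime_three s n1 h₃
      have e₄ := prime_dvd_of_zpow_eq_one Nat.prime_three s n1 h₄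
      rw [Matrix.trace_fin_two] at tψ
      push_cast at e₃ e₄
      simp only [Int.ModEq]
      omega
  · have s := sq_eq_one_of_reflection dφ tφ
    obtain ⟨n1, n2⟩ := reflection_ne dφ
    rcases trace_det_cases (hD ψ) p₄ with ⟨dψ, tψ⟩ | ⟨dψ, tψ⟩ | rfl | ⟨dψ, tψ, hDψ⟩
    · iterate 8 right
      left
      have hψ := eq_one_of_commute_reflection dφ tφ dψ tψ hc'
      refine ⟨hψ, dφ, tφ, ?_⟩
      rw [val_eq_one_iff.mp hψ, one_zpow, mul_one] at h₁ h₂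
      have e₁ := prime_dvd_of_zpow_eq_one Nat.prime_two s n1 h₁
      have e₂ := prime_dvd_of_zpow_eq_one Nat.prime_two s n1 h₂
      rw [Matrix.trace_fin_two] at tφ
      push_cast at e₁ e₂
      simp only [Int.ModEq]
      omega
    · iterate 10 right
      rcases reflections_of_braceCond hB dφ tφ dψ tψ with ⟨h, h'⟩ | ⟨h, h'⟩
      · exact .inl ⟨h, dφ, tφ, h'⟩
      · exact .inr ⟨h, dφ, tφ, h'⟩
    · iterate 9 right
      left
      refine ⟨by simp, dφ, tφ, ?_⟩
      rw [((Commute.neg_one_right φ).zpow_zpow _ _).eq] at h₁ h₂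
      have e₁ := even_of_neg_one_zpow_mul s n1 n2 h₁
      have e₂ := even_of_neg_one_zpow_mul s n1 n2 h₂
      simp only [Int.even_iff] at e₁ e₂
      simp [matModEq_iff, Int.ModEq]
      omega
    · rw [hDψ] at p₃
      exact absurd (eq_one_of_pow_three (by exact_mod_cast p₃) (by rw [tφ]; norm_num)) n1
  · rcases trace_det_cases (hD ψ) p₄ with ⟨dψ, tψ⟩ | ⟨dψ, tψ⟩ | rfl | ⟨dψ, tψ, hDψ⟩
    · exact .inl ⟨by simp, eq_one_or_neg_one_of_sq dψ (sq_eq_one_of_zpow_neg_two (n := -1 - 1) rfl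
        (by simpa using h₂))⟩
    · iterate 7 right
      left
      have s := sq_eq_one_of_reflection dψ tψ
      obtain ⟨n1, n2⟩ := reflection_ne dψ
      refine ⟨by simp, dψ, tψ, ?_⟩
      have e₃ := even_of_neg_one_zpow_mul s n1 n2 h₃
      have e₄ := even_of_neg_one_zpow_mul s n1 n2 h₄
      simp only [Int.even_iff] at e₃ e₄
      simp [matModEq_iff, Int.ModEq]
      omega
    · exact .inl ⟨by simp, by simp⟩
    · rw [hDψ] at p₃
      exact absurd (eq_one_of_pow_three (by exact_mod_cast p₃) (by simp)) neg_one_ne_one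
  · rw [hDφ] at p₁ p₂
    have s : φ ^ 3 = 1 := by exact_mod_cast p₁
    have sψ : ψ ^ 3 = 1 := by exact_mod_cast p₂
    rcases eq_one_or_trace_of_pow_three (coe_pow_three sψ) with hψ | ⟨dψ, tψ⟩
    · iterate 3 right
      left
      have n1 : φ ≠ 1 := by rintro rfl; simp at tφ
      refine ⟨hψ, dφ, tφ, ?_⟩
      rw [val_eq_one_iff.mp hψ, one_zpow, mul_one] at h₁ h₂
      have e₁ := prime_dvd_of_zpow_eq_one Nat.prime_three s n1 h₁
      have e₂ := prime_dvd_of_zpow_eq_one Nat.prime_three s n1 h₂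
      rw [Matrix.trace_fin_two] at tφ
      push_cast at e₁ e₂
      simp only [Int.ModEq]
      omega
    · iterate 4 right
      rcases order_three_of_braceCond hB s dφ tφ dψ tψ with ⟨h, h'⟩ | ⟨h, h'⟩
      · exact .inl ⟨h, dφ, tφ, h'⟩
      · exact .inr (.inl ⟨h, dφ, tφ, h'⟩)
end

section
/- If the pair (φ, ψ) of elements of GL₂(ℤ) satisfies the brace conditions, then neither φ nor ψ has order 4 as an element of the group GL₂(ℤ). -/
/-- An element of order four in `GL₂(ℤ)` has trace `0` and determinant `1`. -/
theorem trace_eq_zero_and_det_eq_one_of_orderOf_eq_four {A : GL (Fin 2) ℤ} (hA : orderOf A = 4) :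
    (A : M2) 0 0 + (A : M2) 1 1 = 0 ∧
      (A : M2) 0 0 * (A : M2) 1 1 - (A : M2) 0 1 * (A : M2) 1 0 = 1 := by
  have h4 : A ^ 4 = 1 := hA ▸ pow_orderOf_eq_one A
  have h2 : A ^ 2 ≠ 1 := pow_ne_one_of_lt_orderOf (by norm_num) (by omega)
  have hdet : IsUnit (A : M2).det := A.isUnit.map Matrix.detMonoidHom
  rw [Int.isUnit_iff, Matrix.det_fin_two] at hdet
  have h4' : (A : M2) ^ 4 = 1 := by rw [← Units.val_pow_eq_pow_val, h4, Units.val_one]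
  have h2' : (A : M2) ^ 2 ≠ 1 := fun h ↦ h2 (Units.ext (by simpa using h))
  generalize (A : M2) = M at *
  have e00 := congrFun (congrFun h4' 0) 0
  have e01 := congrFun (congrFun h4' 0) 1
  have e10 := congrFun (congrFun h4' 1) 0
  have e11 := congrFun (congrFun h4' 1) 1
  simp only [pow_succ, pow_zero, one_mul, Matrix.mul_apply, Fin.sum_univ_two, Matrix.one_apply,
    Fin.isValue, if_true, zero_ne_one, one_ne_zero, if_false] at e00 e01 e10 e11
  have h2'' : ¬ (M 0 0 ^ 2 + M 0 1 * M 1 0 = 1 ∧ M 0 1 * (M 0 0 + M 1 1) = 0 ∧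
      M 1 0 * (M 0 0 + M 1 1) = 0 ∧ M 1 1 ^ 2 + M 0 1 * M 1 0 = 1) := by
    rintro ⟨f00, f01, f10, f11⟩
    refine h2' (Matrix.ext fun i j ↦ ?_)
    fin_cases i <;> fin_cases j <;> simp [pow_two, Matrix.mul_apply, Fin.sum_univ_two] <;> linarith
  clear h2 h2' h4 h4' hA
  generalize M 0 0 = a at *
  generalize M 0 1 = b at *
  generalize M 1 0 = c at *
  generalize M 1 1 = e at *
  obtain ⟨d, hd⟩ : ∃ d, a * e - b * c = d := ⟨_, rfl⟩
  rw [hd] at hdet ⊢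
  by_cases ht : a + e = 0
  · refine ⟨ht, hdet.resolve_right fun hd' ↦ h2'' ⟨?_, ?_, ?_, ?_⟩⟩
    · linear_combination a * ht - hd - hd'
    · rw [ht, mul_zero]
    · rw [ht, mul_zero]
    · linear_combination e * ht - hd - hd'
  · have hk : (a + e) * ((a + e) ^ 2 - 2 * d) ≠ 0 := by
      refine mul_ne_zero ht fun h ↦ ?_
      rcases hdet with rfl | rfl
      · have : (a + e) ^ 2 = 2 := by linarith
        have h1 : a + e < 2 := by nlinarith
        have h2 : -2 < a + e := by nlinarith
        generalize a + e = t at *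
        interval_cases t <;> omega
      · nlinarith [sq_nonneg (a + e)]
    have hb : b = 0 := by
      refine (mul_eq_zero.mp ?_).resolve_left hk
      rw [← hd]
      linear_combination e01
    have hc : c = 0 := by
      refine (mul_eq_zero.mp ?_).resolve_left hk
      rw [← hd]
      linear_combination e10
    have he : a - e = 0 := by
      refine (mul_eq_zero.mp ?_).resolve_left hk
      rw [← hd]
      linear_combination e00 - e11
    obtain rfl : a = e := by linarith
    subst hb hc
    have : a * a = 1 := by rcases hdet with h | h <;> nlinarith
    exact absurd ⟨by linarith, by ring, by ring, by linarith⟩ h2''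

/-- The centralizer in `GL₂(ℤ)` of an element of order four is the cyclic group it generates. -/
theorem exists_eq_zpow_of_commute_of_orderOf_eq_four {A B : GL (Fin 2) ℤ} (hA : orderOf A = 4)
    (h : Commute A B) : ∃ k : ℤ, B = A ^ k := by
  obtain ⟨htr, hdetA⟩ := trace_eq_zero_and_det_eq_one_of_orderOf_eq_four hA
  have hdetB : IsUnit (B : M2).det := B.isUnit.map Matrix.detMonoidHom
  rw [Int.isUnit_iff, Matrix.det_fin_two] at hdetB
  have hsq : A ^ 2 = -1 := by
    refine Units.ext (Matrix.ext fun i j ↦ ?_)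
    fin_cases i <;> fin_cases j <;> simp [pow_two, Matrix.mul_apply, Fin.sum_univ_two]
    · linear_combination (A : M2) 0 0 * htr - hdetA
    · linear_combination (A : M2) 0 1 * htr
    · linear_combination (A : M2) 1 0 * htr
    · linear_combination (A : M2) 1 1 * htr - hdetA
  suffices hB : (B : M2) = 1 ∨ (B : M2) = -1 ∨ (B : M2) = A ∨ (B : M2) = -A by
    rcases hB with hB | hB | hB | hB
    · exact ⟨0, Units.ext (by simpa using hB)⟩
    · refine ⟨2, ?_⟩
      rw [zpow_ofNat, hsq]
      exact Units.ext (by simpa using hB)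
    · exact ⟨1, Units.ext (by simpa using hB)⟩
    · refine ⟨3, ?_⟩
      rw [zpow_ofNat, pow_succ, hsq, neg_one_mul]
      exact Units.ext (by simpa using hB)
  have hc : (A : M2) * B = B * A := congrArg Units.val h.eq
  generalize (A : M2) = M at *
  generalize (B : M2) = N at *
  have c00 := congrFun (congrFun hc 0) 0
  have c01 := congrFun (congrFun hc 0) 1
  have c10 := congrFun (congrFun hc 1) 0
  simp only [Matrix.mul_apply, Fin.sum_univ_two] at c00 c01 c10
  simp only [← Matrix.ext_iff, Fin.forall_fin_two, Matrix.neg_apply, Matrix.one_apply, Fin.isValue,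
    if_true, zero_ne_one, one_ne_zero, if_false]
  clear hc h hsq hA
  generalize M 0 0 = a at *
  generalize M 0 1 = b at *
  generalize M 1 0 = c at *
  generalize M 1 1 = e at *
  generalize N 0 0 = p at *
  generalize N 0 1 = q at *
  generalize N 1 0 = r at *
  generalize N 1 1 = s at *
  obtain rfl : e = -a := by linarith
  obtain ⟨v, hv⟩ : ∃ v, v = -(a * p + b * r + c * q - a * s) := ⟨_, rfl⟩
  obtain ⟨u, hu⟩ : ∃ u, u = p + s := ⟨_, rfl⟩
  have hq : 2 * q = v * b := by
    rw [hv]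
    linear_combination -2 * q * hdetA + b * c00 - a * c01
  have hr : 2 * r = v * c := by
    rw [hv]
    linear_combination -2 * r * hdetA - c * c00 + a * c10
  have hp : p - s = v * a := by
    rw [hv]
    linear_combination -(p - s) * hdetA - b * c10 - a * c00
  have huv : u ^ 2 + v ^ 2 = 4 * (p * s - q * r) := by
    rw [hu]
    linear_combination (p - s + v * a) * hp + 2 * r * hq + v * b * hr - v ^ 2 * hdetA
  have huv4 : u ^ 2 + v ^ 2 = 4 := by
    rcases hdetB with h | h <;> nlinarith [sq_nonneg u, sq_nonneg v]
  have hu1 : u ≤ 2 := by nlinarith [sq_nonneg v]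
  have hu2 : -2 ≤ u := by nlinarith [sq_nonneg v]
  have hv1 : v ≤ 2 := by nlinarith [sq_nonneg u]
  have hv2 : -2 ≤ v := by nlinarith [sq_nonneg u]
  clear hv huv hdetA hdetB c00 c01 c10
  interval_cases u <;> interval_cases v <;> omega

theorem no_order_four (φ ψ : GL (Fin 2) ℤ) (h : BraceCond φ ψ) :
    orderOf φ ≠ 4 ∧ orderOf ψ ≠ 4 := by
  obtain ⟨hc, h1, h2, h3, h4⟩ := h
  constructor <;> intro ho <;>
    obtain ⟨htr, hdet⟩ := trace_eq_zero_and_det_eq_one_of_orderOf_eq_four ho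
  · obtain ⟨k, rfl⟩ := exists_eq_zpow_of_commute_of_orderOf_eq_four ho hc
    rw [← zpow_mul, ← zpow_add, ← orderOf_dvd_iff_zpow_eq_one, ho] at h1 h2
    generalize (φ : M2) 0 0 = a at *
    generalize (φ : M2) 0 1 = b at *
    generalize (φ : M2) 1 0 = c at *
    generalize (φ : M2) 1 1 = e at *
    have h : (4 : ℤ) ∣ 2 := by
      obtain ⟨x, hx⟩ := h1
      obtain ⟨y, hy⟩ := h2
      push_cast at hx hy
      exact ⟨x * (e - 1) - y * c, by linear_combination (e - 1) * hx - c * hy + htr - hdet⟩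
    omega
  · obtain ⟨k, rfl⟩ := exists_eq_zpow_of_commute_of_orderOf_eq_four ho hc.symm
    rw [← zpow_mul, ← zpow_add, ← orderOf_dvd_iff_zpow_eq_one, ho] at h3 h4
    generalize (ψ : M2) 0 0 = a at *
    generalize (ψ : M2) 0 1 = b at *
    generalize (ψ : M2) 1 0 = c at *
    generalize (ψ : M2) 1 1 = e at *
    have h : (4 : ℤ) ∣ 2 := by
      obtain ⟨x, hx⟩ := h3
      obtain ⟨y, hy⟩ := h4
      push_cast at hx hy
      exact ⟨y * (a - 1) - x * b, by linear_combination (a - 1) * hy - b * hx + htr - hdet⟩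
    omega
end

section
/- If the pair (φ, ψ) of elements of GL₂(ℤ) satisfies the brace conditions, then neither φ nor ψ has order 6 as an element of the group GL₂(ℤ). -/
/-- The Cayley–Hamilton identity for a 2×2 integer matrix. -/
lemma sq_eq_trace_smul_sub_det (A : M2) :
    A ^ 2 = A.trace • A - A.det • (1 : M2) := by
  ext i j
  fin_cases i <;> fin_cases j <;>
    simp [-zsmul_eq_mul, -zsmul_one, pow_two, Matrix.mul_apply, Matrix.trace_fin_two, Matrix.det_fin_two] <;> ring

lemma pow_three_eq_smul_sub_smul (A : M2) :
    A ^ 3 = (A.trace ^ 2 - A.det) • A - (A.trace * A.det) • (1 : M2) := by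
  have h := sq_eq_trace_smul_sub_det A
  rw [pow_succ, h, sub_mul, smul_mul_assoc, ← pow_two, h, smul_mul_assoc, one_mul]
  module

lemma pow_six_eq_smul_add_smul (A : M2) :
    A ^ 6 = (A.trace * (A.trace ^ 2 - A.det) * (A.trace ^ 2 - 3 * A.det)) • A +
      (A.trace ^ 2 * A.det ^ 2 - A.det * (A.trace ^ 2 - A.det) ^ 2) • (1 : M2) := by
  rw [show 6 = 3 * 2 from rfl, pow_mul, pow_three_eq_smul_sub_smul, pow_two, sub_mul, mul_sub,
    mul_sub]
  simp only [smul_mul_assoc, mul_smul_comm, one_mul, mul_one]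
  rw [← pow_two, sq_eq_trace_smul_sub_det]
  module

/-- An element of order six in `GL₂(ℤ)` has trace `1` and determinant `1`. -/
lemma trace_eq_one_and_det_eq_one_of_orderOf_eq_six {g : GL (Fin 2) ℤ} (hg : orderOf g = 6) :
    (g : M2).trace = 1 ∧ (g : M2).det = 1 := by
  have pow_ne (n : ℕ) (h0 : n ≠ 0) (hn : n < 6) : (g : M2) ^ n ≠ 1 := fun h =>
    pow_ne_one_of_lt_orderOf h0 (hg ▸ hn) (Units.ext (by simpa using h))
  have pow_six : (g : M2) ^ 6 = 1 := by
    simpa [hg] using congrArg Units.val (pow_orderOf_eq_one g)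
  have hdet : (g : M2).det = 1 ∨ (g : M2).det = -1 :=
    Int.isUnit_iff.mp (Matrix.isUnits_det_units g)
  generalize (g : M2) = A at *
  have hsq := sq_eq_trace_smul_sub_det A
  have hcube := pow_three_eq_smul_sub_smul A
  have hp : A.trace * (A.trace ^ 2 - A.det) * (A.trace ^ 2 - 3 * A.det) = 0 := by
    by_contra hp
    rw [pow_six_eq_smul_add_smul] at pow_six
    have h01 : A 0 1 = 0 := by simpa [-zsmul_eq_mul, -zsmul_one, hp] using congrFun₂ pow_six 0 1
    have h10 : A 1 0 = 0 := by simpa [-zsmul_eq_mul, -zsmul_one, hp] using congrFun₂ pow_six 1 0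
    have h00 := congrFun₂ pow_six 0 0
    have h11 := congrFun₂ pow_six 1 1
    simp only [Matrix.add_apply, Matrix.smul_apply, Matrix.one_apply_eq, smul_eq_mul] at h00 h11
    have hdiag : A 0 0 = A 1 1 := mul_left_cancel₀ hp (by linarith)
    have hmul : A 1 1 * A 1 1 = 1 := by
      rw [Matrix.det_fin_two, h01, hdiag] at hdet
      rcases hdet with h | h <;> nlinarith [mul_self_nonneg (A 1 1)]
    refine pow_ne 2 (by norm_num) (by norm_num) ?_
    ext i j
    fin_cases i <;> fin_cases j <;> simp [pow_two, Matrix.mul_apply, h01, h10, hdiag, hmul]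
  rcases mul_eq_zero.mp hp with hp | hp
  · rcases mul_eq_zero.mp hp with ht | ht
    · refine absurd ?_ (pow_ne 4 (by norm_num) (by norm_num))
      rw [show 4 = 2 * 2 from rfl, pow_mul, hsq, ht]
      rcases hdet with h | h <;> simp [h]
    · have hd : A.det = 1 := by
        rcases hdet with h | h
        · exact h
        · nlinarith [sq_nonneg A.trace]
      rw [hd] at ht hcube
      rcases sq_eq_one_iff.mp (sub_eq_zero.mp ht) with h | h
      · exact ⟨h, hd⟩
      · exact absurd (by rw [hcube, h]; simp) (pow_ne 3 (by norm_num) (by norm_num))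
  · have hsq3 : A.trace ^ 2 = 3 * A.det := by linarith
    rcases hdet with h | h
    · have h1 : A.trace < 2 := by nlinarith
      have h2 : -2 < A.trace := by nlinarith
      interval_cases A.trace <;> omega
    · nlinarith [sq_nonneg A.trace]

/-- If `x ^ p * y ^ q = 1` and `x ^ r * y ^ s = 1`, then the determinant of
`!![p, q; r, s]` annihilates both `x` and `y`. -/
lemma zpow_eq_one_of_mul_zpow_eq_one {G : Type*} [Group G] {x y : G} {p q r s : ℤ}
    (h₁ : x ^ p * y ^ q = 1) (h₂ : x ^ r * y ^ s = 1) :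
    x ^ (p * s - q * r) = 1 ∧ y ^ (p * s - q * r) = 1 := by
  rw [mul_eq_one_iff_eq_inv, ← zpow_neg] at h₁ h₂
  constructor
  · rw [zpow_sub, mul_inv_eq_one, zpow_mul, h₁, mul_comm q, zpow_mul x, h₂, ← zpow_mul, ← zpow_mul]
    ring_nf
  · have h : y ^ (-q * r) = y ^ (-s * p) := by
      rw [zpow_mul, ← h₁, zpow_mul y, ← h₂, ← zpow_mul, ← zpow_mul, mul_comm]
    rw [show p * s - q * r = -q * r - -s * p by ring, zpow_sub, h, mul_inv_cancel]

/-- For a matrix of order six, `det (A - 1) = 1`. -/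
lemma det_sub_one_of_orderOf_eq_six {g : GL (Fin 2) ℤ} (hg : orderOf g = 6) :
    ((g : M2) 0 0 - 1) * ((g : M2) 1 1 - 1) - (g : M2) 1 0 * (g : M2) 0 1 = 1 := by
  obtain ⟨ht, hd⟩ := trace_eq_one_and_det_eq_one_of_orderOf_eq_six hg
  rw [Matrix.trace_fin_two] at ht
  rw [Matrix.det_fin_two] at hd
  linear_combination hd - ht

theorem no_order_six (φ ψ : GL (Fin 2) ℤ) (h : BraceCond φ ψ) :
    orderOf φ ≠ 6 ∧ orderOf ψ ≠ 6 := by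
  obtain ⟨-, h₁, h₂, h₃, h₄⟩ := h
  constructor <;> intro h6
  · have := (zpow_eq_one_of_mul_zpow_eq_one h₁ h₂).1
    rw [det_sub_one_of_orderOf_eq_six h6, zpow_one] at this
    simp [this] at h6
  · have := (zpow_eq_one_of_mul_zpow_eq_one h₃ h₄).2
    rw [det_sub_one_of_orderOf_eq_six h6, zpow_one] at this
    simp [this] at h6
end

section
/- Let φ ∈ GL₂(ℤ) have order 2 and φ ≠ −E. Then the pair (φ, E) satisfies the brace conditions if and only if φ₁₁ is odd and φ₁₂ is even. -/
theorem order_two_psi_eq_E (φ : GL (Fin 2) ℤ) (hord : orderOf φ = 2)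
    (hne : (φ : M2) ≠ -1) :
    BraceCond φ 1 ↔ Odd ((φ : M2) 0 0) ∧ Even ((φ : M2) 0 1) := by
  have zpow_eq_one (n : ℤ) : φ ^ n = 1 ↔ Even n := by
    rw [← orderOf_dvd_iff_zpow_eq_one, hord, even_iff_two_dvd, Nat.cast_ofNat]
  simp [BraceCond, zpow_eq_one]
end

section
/- Let φ ∈ GL₂(ℤ) have order 2 and φ ≠ −E. Then the pair (φ, −E) satisfies the brace conditions if and only if φ₁₁ and φ₂₂ are odd and φ₁₂ and φ₂₁ are even (i.e. φ ≡ E mod 2). -/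
/-- If `φ` is an involution in a group and `φ ≠ 1`, `φ ≠ ε`, where `ε ≠ 1` is another involution,
then `φ ^ a * ε ^ b = 1` if and only if both exponents are even. -/
theorem zpow_mul_zpow_eq_one_iff_even {G : Type*} [Group G] {φ ε : G}
    (hφ : φ ^ 2 = 1) (hε : ε ^ 2 = 1) (hφ1 : φ ≠ 1) (hε1 : ε ≠ 1) (hne : φ ≠ ε) (a b : ℤ) :
    φ ^ a * ε ^ b = 1 ↔ Even a ∧ Even b := by
  have even_zpow {g : G} (hg : g ^ 2 = 1) (k : ℤ) : g ^ (2 * k) = 1 := by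
    rw [zpow_mul, zpow_ofNat, hg, one_zpow]
  have hεinv : ε⁻¹ = ε := by rw [inv_eq_iff_mul_eq_one, ← sq, hε]
  rcases Int.even_or_odd' a with ⟨k, rfl | rfl⟩ <;>
    rcases Int.even_or_odd' b with ⟨l, rfl | rfl⟩ <;>
    simp [zpow_add, even_zpow hφ, even_zpow hε, hφ1, hε1, mul_eq_one_iff_eq_inv, hεinv, hne,
      parity_simps]

theorem order_two_psi_eq_negE (φ : GL (Fin 2) ℤ) (hord : orderOf φ = 2)
    (hne : (φ : M2) ≠ -1) :
    BraceCond φ (-1) ↔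
      Odd ((φ : M2) 0 0) ∧ Odd ((φ : M2) 1 1) ∧
        Even ((φ : M2) 0 1) ∧ Even ((φ : M2) 1 0) := by
  have hsq : φ ^ 2 = 1 := by rw [← pow_orderOf_eq_one φ, hord]
  have hφ1 : φ ≠ 1 := by
    rintro rfl
    simp at hord
  have hφne : φ ≠ -1 := by
    rintro rfl
    simp at hne
  have hneg : (-1 : GL (Fin 2) ℤ) ≠ 1 := by
    intro h
    have h00 := congrArg (fun g : GL (Fin 2) ℤ => (g : M2) 0 0) h
    simp at h00
  have key := zpow_mul_zpow_eq_one_iff_even hsq neg_one_sq hφ1 hneg hφne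
  simp only [BraceCond, key]
  simp [parity_simps]
  tauto
end

section
/- Let φ ∈ GL₂(ℤ) have order 2 and φ ≠ −E. Then the pair (φ, φ) satisfies the brace conditions if and only if φ₁₁ + φ₂₁ is odd and φ₁₂ + φ₂₂ is odd. -/
theorem order_two_psi_eq_phi (φ : GL (Fin 2) ℤ) (hord : orderOf φ = 2)
    (hne : (φ : M2) ≠ -1) :
    BraceCond φ φ ↔
      Odd ((φ : M2) 0 0 + (φ : M2) 1 0) ∧ Odd ((φ : M2) 0 1 + (φ : M2) 1 1) := by
  simp only [BraceCond, ← zpow_add, ← orderOf_dvd_iff_zpow_eq_one, hord, Nat.cast_ofNat,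
    Int.odd_iff, true_and]
  omega
end

section
/- Let φ ∈ GL₂(ℤ) have order 2 and φ ≠ −E. Then the pair (φ, −φ) satisfies the brace conditions if and only if φ₁₁ and φ₂₂ are odd and φ₁₂ and φ₂₁ are even (i.e. φ ≡ E mod 2). -/
/-- Distinct elements `x`, `y` of order two are independent: `x ^ a * y ^ b` is trivial only when
both exponents are even. -/
theorem zpow_mul_zpow_eq_one_iff_even_s6 {G : Type*} [Group G] {x y : G} (hx : orderOf x = 2)
    (hy : orderOf y = 2) (hxy : x ≠ y) (a b : ℤ) :
    x ^ a * y ^ b = 1 ↔ Even a ∧ Even b := by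
  have even_iff {z : G} (hz : orderOf z = 2) (n : ℤ) : z ^ n = 1 ↔ Even n := by
    rw [← orderOf_dvd_iff_zpow_eq_one, hz, even_iff_two_dvd, Nat.cast_ofNat]
  have odd_pow {z : G} (hz : orderOf z = 2) {n : ℤ} (hn : Odd n) : z ^ n = z := by
    obtain ⟨k, rfl⟩ := hn
    rw [zpow_add_one, (even_iff hz _).2 (even_two_mul k), one_mul]
  rcases Int.even_or_odd b with hb | hb
  · rw [(even_iff hy b).2 hb, mul_one, even_iff hx, and_iff_left hb]
  · rw [odd_pow hy hb]
    refine ⟨fun h => ?_, fun h => absurd h.2 (Int.not_even_iff_odd.2 hb)⟩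
    rcases Int.even_or_odd a with ha | ha
    · rw [(even_iff hx a).2 ha, one_mul] at h
      simp [h] at hy
    · rw [odd_pow hx ha] at h
      have hyy : y * y = 1 := by rw [← pow_two, ← hy, pow_orderOf_eq_one]
      exact absurd (mul_right_cancel (h.trans hyy.symm)) hxy

theorem order_two_psi_eq_neg_phi (φ : GL (Fin 2) ℤ) (hord : orderOf φ = 2)
    (hne : (φ : M2) ≠ -1) :
    BraceCond φ (-φ) ↔
      Odd ((φ : M2) 0 0) ∧ Odd ((φ : M2) 1 1) ∧
        Even ((φ : M2) 0 1) ∧ Even ((φ : M2) 1 0) := by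
  have hsq : φ ^ 2 = 1 := (orderOf_eq_iff two_pos).1 hord |>.1
  have hne_one : -φ ≠ 1 := fun h => hne <| by
    rw [neg_eq_iff_eq_neg.1 h, Units.val_neg, Units.val_one]
  have hord_neg : orderOf (-φ) = 2 := orderOf_eq_prime (by rw [neg_sq, hsq]) hne_one
  have hne_neg : φ ≠ -φ := fun h => by
    have hv : (φ : M2) = -(φ : M2) := congrArg Units.val h
    exact φ.ne_zero (Matrix.ext fun i j => self_eq_neg.1 (congrFun₂ hv i j))
  simp only [BraceCond, zpow_mul_zpow_eq_one_iff_even_s6 hord hord_neg hne_neg, Units.val_neg,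
    Matrix.neg_apply, mul_neg, neg_mul, true_and, even_neg, Int.even_sub_one,
    Int.not_even_iff_odd]
  tauto
end

section
/- Let φ ∈ GL₂(ℤ) have order 3. Then the pair (φ, φ) satisfies the brace conditions if and only if φ₁₁ + φ₂₁ ≡ 1 (mod 3) and φ₁₂ + φ₂₂ ≡ 1 (mod 3). -/
theorem zpow_eq_one_iff_emod_three {G : Type*} [Group G] {g : G} (hg : orderOf g = 3) (n : ℤ) :
    g ^ n = 1 ↔ n % 3 = 0 := by
  rw [← orderOf_dvd_iff_zpow_eq_one, hg, Int.dvd_iff_emod_eq_zero, Nat.cast_ofNat]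

theorem order_three_psi_eq_phi (φ : GL (Fin 2) ℤ) (hord : orderOf φ = 3) :
    BraceCond φ φ ↔
      (φ : M2) 0 0 + (φ : M2) 1 0 ≡ 1 [ZMOD 3] ∧
        (φ : M2) 0 1 + (φ : M2) 1 1 ≡ 1 [ZMOD 3] := by
  simp only [BraceCond, ← zpow_add, zpow_eq_one_iff_emod_three hord, Int.ModEq, true_and]
  omega
end

section
/- Let φ ∈ GL₂(ℤ) have order 3. Then the pair (φ, −φ) does not satisfy the brace conditions. -/
theorem order_three_psi_eq_neg_phi (φ : GL (Fin 2) ℤ) (hord : orderOf φ = 3) :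
    ¬ BraceCond φ (-φ) := by
  rintro ⟨-, h₁, -, h₂, -⟩
  have hψ₁ := eq_inv_of_mul_eq_one_right h₁
  have hψ₂ := eq_inv_of_mul_eq_one_right h₂
  simp only [Units.val_neg, Matrix.neg_apply, zpow_neg (-φ)] at hψ₂
  rw [hψ₁, inv_inv, ← zpow_neg, zpow_eq_zpow_iff_modEq, hord] at hψ₂
  have := hψ₂.dvd
  push_cast at this
  omega
end

section
/- Let φ ∈ GL₂(ℤ) have order 3. Then the pair (φ, φ⁻¹) satisfies the brace conditions if and only if φ₁₁ − φ₂₁ ≡ 1 (mod 3) and φ₁₁ + φ₁₂ ≡ 1 (mod 3). -/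
/-- A `2 × 2` integer matrix with `A ^ 3 = 1` has determinant `1`. -/
theorem det_eq_one_of_pow_three_eq_one {A : M2} (h : A ^ 3 = 1) : A.det = 1 := by
  have hdet : A.det ^ 3 = 1 := by rw [← Matrix.det_pow, h, Matrix.det_one]
  exact (Odd.strictMono_pow (by decide : Odd 3)).injective (by simpa using hdet)

/-- A `2 × 2` integer matrix `A ≠ 1` with `A ^ 3 = 1` has trace `-1`. -/
theorem trace_eq_neg_one_of_pow_three_eq_one {A : M2} (h : A ^ 3 = 1) (hA : A ≠ 1) :
    A 0 0 + A 1 1 = -1 := by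
  have hdet := det_eq_one_of_pow_three_eq_one h
  rw [Matrix.det_fin_two] at hdet
  have entry (i j : Fin 2) : (A ^ 3) i j = (1 : M2) i j := by rw [h]
  have h00 := entry 0 0
  have h01 := entry 0 1
  have h10 := entry 1 0
  have h11 := entry 1 1
  simp [pow_succ, Matrix.mul_apply, Fin.sum_univ_two] at h00 h01 h10 h11
  have hext : ¬ (A 0 0 = 1 ∧ A 0 1 = 0 ∧ A 1 0 = 0 ∧ A 1 1 = 1) := by
    rintro ⟨h₁, h₂, h₃, h₄⟩
    exact hA (by ext i j; fin_cases i <;> fin_cases j <;> simp [h₁, h₂, h₃, h₄])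
  generalize A 0 0 = a at *
  generalize A 0 1 = b at *
  generalize A 1 0 = c at *
  generalize A 1 1 = d at *
  by_contra htr
  have htr' : a + d + 1 ≠ 0 := by omega
  -- By Cayley–Hamilton, `A ^ 3 = (t ^ 2 - 1) A - t` with `t` the trace.
  have ha : (a + d - 1) * a = 1 := mul_left_cancel₀ htr' (by
    linear_combination h00 + (2 * a + d) * hdet)
  have hd : (a + d - 1) * d = 1 := mul_left_cancel₀ htr' (by
    linear_combination h11 + (a + 2 * d) * hdet)
  have hne : a + d - 1 ≠ 0 := left_ne_zero_of_mul_eq_one ha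
  have had : a = d := mul_left_cancel₀ hne (ha.trans hd.symm)
  subst had
  have ha1 : a = 1 := by
    have : (2 * a + 1) * (a - 1) = 0 := by linear_combination ha
    rcases mul_eq_zero.1 this with h | h <;> omega
  subst ha1
  have hb : b = 0 := by linarith [show 3 * b = 0 by linear_combination h01 + b * hdet]
  have hc : c = 0 := by linarith [show 3 * c = 0 by linear_combination h10 + c * hdet]
  exact hext ⟨rfl, hb, hc, rfl⟩

theorem order_three_psi_eq_phi_inv (φ : GL (Fin 2) ℤ) (hord : orderOf φ = 3) :
    BraceCond φ φ⁻¹ ↔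
      (φ : M2) 0 0 - (φ : M2) 1 0 ≡ 1 [ZMOD 3] ∧
        (φ : M2) 0 0 + (φ : M2) 0 1 ≡ 1 [ZMOD 3] := by
  have hpow : (φ : M2) ^ 3 = 1 := by
    rw [← Units.val_pow_eq_pow_val, ← hord, pow_orderOf_eq_one, Units.val_one]
  have hne : (φ : M2) ≠ 1 := fun h ↦ by
    have : φ = 1 := Units.ext h
    simp [this] at hord
  have htr := trace_eq_neg_one_of_pow_three_eq_one hpow hne
  have hinv : ((φ⁻¹ : GL (Fin 2) ℤ) : M2) = !![φ 1 1, -φ 0 1; -φ 1 0, φ 0 0] := by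
    rw [Matrix.coe_units_inv, Matrix.inv_def, det_eq_one_of_pow_three_eq_one hpow,
      Matrix.adjugate_fin_two]
    simp
  have hzpow (m n : ℤ) : φ ^ m * φ⁻¹ ^ n = 1 ↔ (3 : ℤ) ∣ m - n := by
    rw [inv_zpow', ← zpow_add, ← sub_eq_add_neg, ← orderOf_dvd_iff_zpow_eq_one, hord]
    rfl
  have hcomm : φ * φ⁻¹ = φ⁻¹ * φ := by simp
  simp only [BraceCond, hzpow, hinv, hcomm, true_and, Int.modEq_iff_dvd, Matrix.of_apply,
    Matrix.cons_val', Matrix.cons_val_zero, Matrix.cons_val_one, Matrix.cons_val_fin_one]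
  omega
end

section
/- Let φ ∈ GL₂(ℤ) have order 3. Then the pair (φ, −φ⁻¹) does not satisfy the brace conditions. -/
/-- A nontrivial integer `2 × 2` matrix with `A ^ 3 = 1` is a root of `X ^ 2 + X + 1`. -/
theorem sq_add_self_add_one_eq_zero_of_pow_three {A : M2} (h3 : A ^ 3 = 1) (h1 : A ≠ 1) :
    A ^ 2 + A + 1 = 0 := by
  have hdet : A.det = 1 := by
    have h : A.det ^ 3 = 1 := by rw [← Matrix.det_pow, h3, Matrix.det_one]
    exact (Odd.strictMono_pow (by decide : Odd 3)).injective (by simpa using h)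
  have hCH : A ^ 2 - A.trace • A + 1 = 0 := by
    rw [← one_smul ℤ (1 : M2), ← hdet]
    ext i j
    fin_cases i <;> fin_cases j <;>
      simp [-zsmul_eq_mul, -zsmul_one, pow_two, Matrix.mul_apply, Matrix.trace_fin_two,
        Matrix.det_fin_two] <;> ring
  have hsq : A ^ 2 = A.trace • A - 1 := by
    rw [← sub_eq_zero, ← hCH]
    abel
  have hfactor : (A.trace + 1) • ((A.trace - 1) • A - 1) = 0 := by
    have hcube : A ^ 3 = A.trace • A ^ 2 - A := by
      rw [pow_succ, hsq, sub_mul, smul_mul_assoc, ← pow_two, one_mul, hsq]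
    rw [h3, hsq] at hcube
    rw [← sub_eq_zero] at hcube
    rw [← neg_eq_zero, ← hcube]
    module
  rcases smul_eq_zero.mp hfactor with ht | hs
  · rw [hsq, eq_neg_of_add_eq_zero_left ht]
    module
  · refine absurd ?_ h1
    have htr : (A.trace - 1) * A.trace = 2 := by
      simpa [-zsmul_eq_mul, sub_eq_zero] using congrArg Matrix.trace hs
    have hd : (A.trace - 1) ^ 2 = 1 := by
      have h := congrArg Matrix.det (sub_eq_zero.mp hs)
      simpa [-zsmul_eq_mul, Matrix.det_smul, hdet] using h
    have ht : A.trace = 2 := by nlinarith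
    simpa [ht, sub_eq_zero] using hs

theorem order_three_psi_eq_neg_phi_inv (φ : GL (Fin 2) ℤ) (hord : orderOf φ = 3) :
    ¬ BraceCond φ (-φ⁻¹) := by
  intro ⟨_, h₁, _, h₂, _⟩
  have hne : φ ≠ 1 := fun h => by simp [h] at hord
  have h3 : φ ^ 3 = 1 := hord ▸ pow_orderOf_eq_one φ
  have hroot : (φ : M2) ^ 2 + φ + 1 = 0 :=
    sq_add_self_add_one_eq_zero_of_pow_three (by simpa using congrArg Units.val h3)
      (fun h => hne (Units.ext h))
  have hinv : ((φ⁻¹ : GL (Fin 2) ℤ) : M2) = -(φ + 1) := by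
    apply Units.inv_eq_of_mul_eq_one_right
    rw [mul_neg, mul_add, mul_one, ← pow_two]
    exact (eq_neg_of_add_eq_zero_right hroot).symm
  have hpsi : ((-φ⁻¹ : GL (Fin 2) ℤ) : M2) = φ + 1 := by
    rw [Units.val_neg, hinv, neg_neg]
  have h₀₀ : ((-φ⁻¹ : GL (Fin 2) ℤ) : M2) 0 0 - 1 = (φ : M2) 0 0 - 1 + 1 := by
    simp [hpsi]
  have h₁₀ : ((-φ⁻¹ : GL (Fin 2) ℤ) : M2) 1 0 = (φ : M2) 1 0 := by
    simp [hpsi]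
  rw [h₀₀, h₁₀, zpow_add_one] at h₂
  have hpow := mul_right_cancel (h₂.trans h₁.symm)
  exact hne (mul_eq_left.mp hpow)
end

section
/- Let φ ∈ GL₂(ℤ) have infinite order and suppose the pair (φ, ψ) satisfies the brace conditions with ψ = E or ψ = −E. Then ψ = E, and φ₁₁ = 1, φ₁₂ = 0, φ₂₂ = 1; that is, φ = [[1, 0], [m, 1]] for some integer m. -/
/-- A group element with no trivial positive power has no trivial nonzero integer power. -/
theorem eq_zero_of_zpow_eq_one_of_forall_pow_ne_one {G : Type*} [Group G] {g : G}
    (hg : ∀ n : ℕ, 0 < n → g ^ n ≠ 1) {z : ℤ} (hz : g ^ z = 1) : z = 0 := by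
  by_contra hne
  exact hg z.natAbs (Int.natAbs_pos.mpr hne) (pow_natAbs_eq_one.mpr hz)

theorem infinite_order_psi_pm_E (φ ψ : GL (Fin 2) ℤ)
    (hinf : ∀ n : ℕ, 0 < n → φ ^ n ≠ 1)
    (hψ : (ψ : M2) = 1 ∨ (ψ : M2) = -1)
    (h : BraceCond φ ψ) :
    (ψ : M2) = 1 ∧ (φ : M2) 0 0 = 1 ∧ (φ : M2) 0 1 = 0 ∧ (φ : M2) 1 1 = 1 ∧
      ∃ m : ℤ, (φ : M2) = !![1, 0; m, 1] := by
  obtain ⟨-, h1, h2, h3, -⟩ := h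
  have key {z : ℤ} (hz : φ ^ z = 1) : z = 0 :=
    eq_zero_of_zpow_eq_one_of_forall_pow_ne_one hinf hz
  rcases hψ with hψ | hψ
  · obtain rfl : ψ = 1 := Units.ext hψ
    rw [one_zpow, mul_one] at h1 h2
    have ha : (φ : M2) 0 0 = 1 := by linarith [key h1]
    have hb : (φ : M2) 0 1 = 0 := key h2
    have hdet : IsUnit (φ : M2).det := (Matrix.isUnit_iff_isUnit_det _).mp φ.isUnit
    rw [Matrix.det_fin_two, ha, hb, one_mul, zero_mul, sub_zero, Int.isUnit_iff] at hdet
    have hd : (φ : M2) 1 1 = 1 := by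
      refine hdet.resolve_right fun hd => hinf 2 two_pos (Units.ext ?_)
      ext i j
      fin_cases i <;> fin_cases j <;> simp [pow_two, Matrix.mul_apply, Fin.sum_univ_two, ha, hb, hd]
    refine ⟨rfl, ha, hb, hd, (φ : M2) 1 0, ?_⟩
    rw [Matrix.eta_fin_two (φ : M2), ha, hb, hd]
    rfl
  · rw [hψ] at h3
    have h00 : (-1 : M2) 0 0 = -1 := rfl
    have h10 : (-1 : M2) 1 0 = 0 := rfl
    rw [h00, h10, zpow_zero, mul_one] at h3
    exact absurd (key h3) (by norm_num)
end

section
/- Let φ ∈ GL₂(ℤ) have infinite order, let ψ ∈ GL₂(ℤ) with ψ ≠ E and ψ ≠ −E, and suppose the pair (φ, ψ) satisfies the brace conditions. Then there exist integers p, q, m with gcd(p, q) = 1 such that φ = [[1+mp²q, mpq²], [−mp³, 1−mp²q]] and ψ = [[1+mpq², mq³], [−mp²q, 1−mpq²]]. -/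
/-- Two relations `g ^ i * h ^ j = 1` are proportional when `g` has infinite order. -/
lemma mul_eq_mul_of_zpow_mul_zpow_eq_one {G : Type*} [Group G] {g h : G}
    (hg : ∀ n : ℕ, 0 < n → g ^ n ≠ 1) {i j i' j' : ℤ}
    (h₁ : g ^ i * h ^ j = 1) (h₂ : g ^ i' * h ^ j' = 1) : i * j' = j * i' := by
  have hinj : Function.Injective fun n : ℤ => g ^ n := by
    rw [injective_zpow_iff_not_isOfFinOrder, isOfFinOrder_iff_pow_eq_one]
    rintro ⟨n, hn, hn'⟩
    exact hg n hn hn'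
  apply hinj
  have e₁ : g ^ i = h ^ (-j) := by rw [zpow_neg]; exact eq_inv_of_mul_eq_one_left h₁
  have e₂ : g ^ i' = h ^ (-j') := by rw [zpow_neg]; exact eq_inv_of_mul_eq_one_left h₂
  change g ^ (i * j') = g ^ (j * i')
  rw [zpow_mul, e₁, mul_comm j, zpow_mul, e₂, ← zpow_mul, ← zpow_mul]
  congr 1
  ring

/-- An integer vector orthogonal to a primitive vector `(p, q)` is a multiple of `(q, -p)`. -/
lemma IsCoprime.exists_eq_mul_of_orthogonal {p q : ℤ} (h : IsCoprime p q) {x y : ℤ}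
    (hxy : p * x + q * y = 0) : ∃ s, x = q * s ∧ y = -(p * s) := by
  obtain ⟨α, β, hαβ⟩ := h
  refine ⟨β * x - α * y, ?_, ?_⟩
  · linear_combination (-x) * hαβ + α * hxy
  · linear_combination (-y) * hαβ + β * hxy

/-- All integer vectors proportional to a given nonzero one are multiples of one primitive
vector. -/
lemma exists_isCoprime_forall_eq_mul {a b : ℤ} (hab : a ≠ 0 ∨ b ≠ 0) :
    ∃ p q : ℤ, IsCoprime p q ∧
      ∀ x y : ℤ, a * y = b * x → ∃ s, x = q * s ∧ y = -(p * s) := by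
  have hg : 0 < Int.gcd a b := Int.gcd_pos_iff.mpr hab
  obtain ⟨q, p, hqp, ha, hb⟩ := Int.exists_gcd_one hg
  have hc : IsCoprime (-p) q := (Int.isCoprime_iff_gcd_eq_one.mpr hqp).symm.neg_left
  refine ⟨-p, q, hc, fun x y hxy => hc.exists_eq_mul_of_orthogonal ?_⟩
  have hg' : (Int.gcd a b : ℤ) ≠ 0 := by positivity
  apply mul_left_cancel₀ hg'
  linear_combination hxy - y * ha + x * hb

/-- Integer powers of a unipotent element `1 + k • M` with `M * M = 0`. -/
lemma Units.coe_zpow_of_eq_one_add_smul {R : Type*} [Ring R] {M : R} (hM : M * M = 0)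
    {u : Rˣ} {k : ℤ} (hu : (u : R) = 1 + k • M) (n : ℤ) :
    ((u ^ n : Rˣ) : R) = 1 + (n * k) • M := by
  have hmul (a b : ℤ) : (1 + a • M) * (1 + b • M) = 1 + (a + b) • M := by
    simp only [mul_add, add_mul, one_mul, mul_one, smul_mul_assoc, mul_smul_comm, hM, smul_zero,
      add_zero, add_smul]
    abel
  have hinv : ((u⁻¹ : Rˣ) : R) = 1 + (-k) • M := by
    rw [Units.inv_eq_of_mul_eq_one_right]
    rw [hu, hmul]
    simp
  induction n using Int.induction_on with
  | zero => simp
  | succ n ih => rw [zpow_add_one, Units.val_mul, ih, hu, hmul]; congr 2; ring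
  | pred n ih => rw [zpow_sub_one, Units.val_mul, ih, hinv, hmul]; congr 2; ring

lemma Matrix.GeneralLinearGroup.det_eq_one_or_neg_one (φ : GL (Fin 2) ℤ) :
    (φ : M2) 0 0 * (φ : M2) 1 1 - (φ : M2) 0 1 * (φ : M2) 1 0 = 1 ∨
      (φ : M2) 0 0 * (φ : M2) 1 1 - (φ : M2) 0 1 * (φ : M2) 1 0 = -1 := by
  rw [← Matrix.det_fin_two]
  exact Int.isUnit_iff.mp ((Matrix.isUnit_iff_isUnit_det _).mp φ.isUnit)

theorem infinite_order_psi_not_pm_E (φ ψ : GL (Fin 2) ℤ)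
    (hinf : ∀ n : ℕ, 0 < n → φ ^ n ≠ 1)
    (hψ1 : (ψ : M2) ≠ 1) (hψ2 : (ψ : M2) ≠ -1)
    (h : BraceCond φ ψ) :
    ∃ p q m : ℤ, Int.gcd p q = 1 ∧
      (φ : M2) = !![1 + m * p ^ 2 * q, m * p * q ^ 2; -(m * p ^ 3), 1 - m * p ^ 2 * q] ∧
      (ψ : M2) = !![1 + m * p * q ^ 2, m * q ^ 3; -(m * p ^ 2 * q), 1 - m * p * q ^ 2] := by
  obtain ⟨hcomm, h₁, h₂, h₃, h₄⟩ := h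
  have hφ1 : (φ : M2) ≠ 1 := fun e => hinf 1 one_pos (by rw [pow_one]; exact Units.ext e)
  have hprim : ∃ p q : ℤ, IsCoprime p q ∧
      ∀ x y : ℤ, φ ^ x * ψ ^ y = 1 → ∃ s, x = q * s ∧ y = -(p * s) := by
    by_cases hv : (φ : M2) 0 0 - 1 ≠ 0 ∨ (φ : M2) 1 0 ≠ 0
    · obtain ⟨p, q, hpq, hs⟩ := exists_isCoprime_forall_eq_mul hv
      exact ⟨p, q, hpq, fun x y hxy => hs x y (mul_eq_mul_of_zpow_mul_zpow_eq_one hinf h₁ hxy)⟩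
    · have hv' : (φ : M2) 0 1 ≠ 0 ∨ (φ : M2) 1 1 - 1 ≠ 0 := by
        by_contra! hw
        push Not at hv
        apply hφ1
        ext i j
        fin_cases i <;> fin_cases j <;> simp <;> omega
      obtain ⟨p, q, hpq, hs⟩ := exists_isCoprime_forall_eq_mul hv'
      exact ⟨p, q, hpq, fun x y hxy => hs x y (mul_eq_mul_of_zpow_mul_zpow_eq_one hinf h₂ hxy)⟩
  obtain ⟨p, q, hpq, hs⟩ := hprim
  obtain ⟨s, ha, hc⟩ := hs _ _ h₁
  obtain ⟨t, hb, hd⟩ := hs _ _ h₂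
  obtain ⟨u, hx, hz⟩ := hs _ _ h₃
  obtain ⟨v, hy, hw⟩ := hs _ _ h₄
  have hφ : (φ : M2) = !![1 + q * s, q * t; -(p * s), 1 - p * t] := by
    ext i j
    fin_cases i <;> fin_cases j <;> simp <;> linarith
  have hψ : (ψ : M2) = !![1 + q * u, q * v; -(p * u), 1 - p * v] := by
    ext i j
    fin_cases i <;> fin_cases j <;> simp <;> linarith
  have hst : p * t + q * (-s) = 0 := by
    rcases φ.det_eq_one_or_neg_one with hdet | hdet <;> simp [hφ] at hdet
    · linear_combination -hdet
    · refine absurd (Units.ext ?_) (hinf 2 two_pos)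
      rw [Units.val_pow_eq_pow_val, Units.val_one, hφ, sq, Matrix.mul_fin_two]
      ext i j
      fin_cases i <;> fin_cases j <;> simp
      · linear_combination q * s * hdet
      · linear_combination q * t * hdet
      · linear_combination (-p) * s * hdet
      · linear_combination (-p) * t * hdet
  obtain ⟨k, rfl, hk⟩ := hpq.exists_eq_mul_of_orthogonal hst
  obtain rfl : s = p * k := by linarith
  have hk0 : k ≠ 0 := by
    rintro rfl
    apply hφ1
    rw [hφ, Matrix.one_fin_two]
    simp
  have huv : p * v + q * (-u) = 0 := by
    rcases ψ.det_eq_one_or_neg_one with hdet | hdet <;> simp [hψ] at hdet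
    · linear_combination -hdet
    · exfalso
      have hcm : (φ : M2) * ψ = ψ * φ := by simpa using congrArg Units.val hcomm
      rw [hφ, hψ, Matrix.mul_fin_two, Matrix.mul_fin_two] at hcm
      have e₁ := congrFun (congrFun hcm 0) 1
      have e₂ := congrFun (congrFun hcm 1) 0
      simp at e₁ e₂
      have hq : q = 0 := by
        have : 2 * (k * q ^ 2) = 0 := by linear_combination e₁ + (k * q ^ 2) * hdet
        simpa [hk0] using this
      have hp : p = 0 := by
        have : 2 * (k * p ^ 2) = 0 := by linear_combination -e₂ + (k * p ^ 2) * hdet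
        simpa [hk0] using this
      exact not_isCoprime_zero_zero (hp ▸ hq ▸ hpq)
  obtain ⟨l, rfl, hl⟩ := hpq.exists_eq_mul_of_orthogonal huv
  obtain rfl : u = p * l := by linarith
  let M : M2 := !![p * q, q ^ 2; -p ^ 2, -(p * q)]
  have hM : M * M = 0 := by
    ext i j
    fin_cases i <;> fin_cases j <;> simp [M, Matrix.mul_apply] <;> ring
  have hφM : (φ : M2) = 1 + k • M := by
    rw [hφ]
    ext i j
    fin_cases i <;> fin_cases j <;> simp [M] <;> ring
  have hψM : (ψ : M2) = 1 + l • M := by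
    rw [hψ]
    ext i j
    fin_cases i <;> fin_cases j <;> simp [M] <;> ring
  have hM0 : M ≠ 0 := by
    intro e
    have e₁ := congrFun (congrFun e 0) 1
    have e₂ := congrFun (congrFun e 1) 0
    simp [M] at e₁ e₂
    exact not_isCoprime_zero_zero (e₁ ▸ e₂ ▸ hpq)
  have hrel {i j : ℤ} (hij : φ ^ i * ψ ^ j = 1) : i * k + j * l = 0 := by
    have e := congrArg Units.val hij
    rw [Units.val_mul, Units.coe_zpow_of_eq_one_add_smul hM hφM,
      Units.coe_zpow_of_eq_one_add_smul hM hψM] at e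
    simp only [mul_add, add_mul, one_mul, mul_one, smul_mul_assoc, mul_smul_comm, hM, smul_zero,
      add_zero, Units.val_one, add_assoc, add_eq_left] at e
    rw [← add_smul] at e
    exact (smul_eq_zero.mp e).resolve_right hM0
  have r₁ := hrel h₁
  have r₂ := hrel h₂
  rw [ha, hc] at r₁
  rw [hb, hd] at r₂
  have hkl : p * l + q * (-k) = 0 := by
    obtain ⟨α, β, hαβ⟩ := hpq
    apply mul_left_cancel₀ hk0
    linear_combination (-α) * r₁ - β * r₂ - k * (p * l - q * k) * hαβ
  obtain ⟨m, rfl, hm⟩ := hpq.exists_eq_mul_of_orthogonal hkl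
  obtain rfl : k = p * m := by linarith
  refine ⟨p, q, m, Int.isCoprime_iff_gcd_eq_one.mp hpq, ?_, ?_⟩
  · rw [hφ]
    congr! 3 <;> ring_nf
  · rw [hψ]
    congr! 3 <;> ring_nf
end

section
/- For all integers p, q, m with gcd(p, q) = 1, the matrices φ = [[1+mp²q, mpq²], [−mp³, 1−mp²q]] and ψ = [[1+mpq², mq³], [−mp²q, 1−mpq²]] have determinant 1 (so they lie in GL₂(ℤ)), they commute, and the pair (φ, ψ) satisfies the brace conditions. -/
/-- For `N` with `N * N = 0`, the one-parameter group `t ↦ 1 + t • N` of units. -/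
def unipotentHom {R : Type*} [Ring R] (N : R) (hN : N * N = 0) : Multiplicative ℤ →* Rˣ :=
  MonoidHom.toHomUnits
    { toFun := fun t => 1 + t.toAdd • N
      map_one' := by simp
      map_mul' := fun s t => by
        simp only [toAdd_mul, add_smul, mul_add, add_mul, one_mul, mul_one, smul_mul_smul_comm,
          hN, smul_zero, add_zero]
        abel }

theorem coe_unipotentHom {R : Type*} [Ring R] (N : R) (hN : N * N = 0) (t : ℤ) :
    (unipotentHom N hN (Multiplicative.ofAdd t) : R) = 1 + t • N := rfl

theorem unipotentHom_zpow_mul_zpow {R : Type*} [Ring R] (N : R) (hN : N * N = 0)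
    {s t a b : ℤ} (hab : a * s + b * t = 0) :
    unipotentHom N hN (Multiplicative.ofAdd s) ^ a *
      unipotentHom N hN (Multiplicative.ofAdd t) ^ b = 1 := by
  rw [← map_zpow (unipotentHom N hN), ← map_zpow (unipotentHom N hN),
    ← map_mul (unipotentHom N hN), ← ofAdd_zsmul, ← ofAdd_zsmul, ← ofAdd_add,
    smul_eq_mul, smul_eq_mul, hab, ofAdd_zero, map_one]

theorem parabolic_pairs_satisfy_brace_conditions (p q m : ℤ) (h : Int.gcd p q = 1) :
    Matrix.det (!![1 + m * p ^ 2 * q, m * p * q ^ 2;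
        -(m * p ^ 3), 1 - m * p ^ 2 * q] : M2) = 1 ∧
    Matrix.det (!![1 + m * p * q ^ 2, m * q ^ 3;
        -(m * p ^ 2 * q), 1 - m * p * q ^ 2] : M2) = 1 ∧
    (!![1 + m * p ^ 2 * q, m * p * q ^ 2; -(m * p ^ 3), 1 - m * p ^ 2 * q] : M2) *
        !![1 + m * p * q ^ 2, m * q ^ 3; -(m * p ^ 2 * q), 1 - m * p * q ^ 2] =
      !![1 + m * p * q ^ 2, m * q ^ 3; -(m * p ^ 2 * q), 1 - m * p * q ^ 2] *
        !![1 + m * p ^ 2 * q, m * p * q ^ 2; -(m * p ^ 3), 1 - m * p ^ 2 * q] ∧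
    ∀ φ ψ : GL (Fin 2) ℤ,
      (φ : M2) = !![1 + m * p ^ 2 * q, m * p * q ^ 2; -(m * p ^ 3), 1 - m * p ^ 2 * q] →
      (ψ : M2) = !![1 + m * p * q ^ 2, m * q ^ 3; -(m * p ^ 2 * q), 1 - m * p * q ^ 2] →
      BraceCond φ ψ := by
  refine ⟨by rw [Matrix.det_fin_two_of]; ring, by rw [Matrix.det_fin_two_of]; ring, ?_, ?_⟩
  · ext i j
    fin_cases i <;> fin_cases j <;> simp [Matrix.mul_apply, Fin.sum_univ_two] <;> ring
  intro φ ψ hφ hψ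
  set N : M2 := !![p * q, q ^ 2; -p ^ 2, -(p * q)] with N_def
  have hN : N * N = 0 := by
    ext i j
    fin_cases i <;> fin_cases j <;> simp [N_def, Matrix.mul_apply, Fin.sum_univ_two] <;> ring
  have hφN : φ = unipotentHom N hN (Multiplicative.ofAdd (m * p)) := by
    apply Units.ext
    rw [hφ, coe_unipotentHom]
    ext i j
    fin_cases i <;> fin_cases j <;> simp [N_def] <;> ring
  have hψN : ψ = unipotentHom N hN (Multiplicative.ofAdd (m * q)) := by
    apply Units.ext
    rw [hψ, coe_unipotentHom]
    ext i j
    fin_cases i <;> fin_cases j <;> simp [N_def] <;> ring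
  unfold BraceCond
  rw [hφ, hψ, hφN, hψN]
  refine ⟨(Commute.all _ _).map (unipotentHom N hN), ?_, ?_, ?_, ?_⟩ <;>
    apply unipotentHom_zpow_mul_zpow <;> simp <;> ring
end

section
/- Let ψ ∈ GL₂(ℤ) have order 2 and ψ ≠ −E. Then the pair (−E, ψ) satisfies the brace conditions if and only if ψ₁₁ and ψ₂₂ are odd and ψ₁₂ and ψ₂₁ are even (i.e. ψ ≡ E mod 2). -/
theorem zpow_eq_one_of_sq_eq_one_of_even {G : Type*} [Group G] {g : G} (hg : g ^ 2 = 1) {n : ℤ}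
    (hn : Even n) : g ^ n = 1 := by
  obtain ⟨k, rfl⟩ := hn
  rw [← two_mul, zpow_mul, zpow_ofNat, hg, one_zpow]

theorem zpow_eq_self_of_sq_eq_one_of_odd {G : Type*} [Group G] {g : G} (hg : g ^ 2 = 1) {n : ℤ}
    (hn : Odd n) : g ^ n = g := by
  obtain ⟨k, rfl⟩ := hn
  rw [zpow_add, zpow_one, zpow_eq_one_of_sq_eq_one_of_even hg (even_two_mul k), one_mul]

/-- Two involutions that are distinct and nontrivial admit no relation `g ^ m * h ^ n = 1`
other than the obvious ones. -/
theorem zpow_mul_zpow_eq_one_iff_even_s18 {G : Type*} [Group G] {g h : G} (hg : g ^ 2 = 1)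
    (hh : h ^ 2 = 1) (hg1 : g ≠ 1) (hh1 : h ≠ 1) (hgh : g ≠ h) (m n : ℤ) :
    g ^ m * h ^ n = 1 ↔ Even m ∧ Even n := by
  have hinv : h⁻¹ = h := inv_eq_of_mul_eq_one_left (by rwa [← sq])
  rcases Int.even_or_odd m with hm | hm <;> rcases Int.even_or_odd n with hn | hn
  · simp [zpow_eq_one_of_sq_eq_one_of_even, *]
  · simp [zpow_eq_one_of_sq_eq_one_of_even hg hm, zpow_eq_self_of_sq_eq_one_of_odd hh hn, hh1,
      Int.not_even_iff_odd.2 hn]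
  · simp [zpow_eq_self_of_sq_eq_one_of_odd hg hm, zpow_eq_one_of_sq_eq_one_of_even hh hn, hg1,
      Int.not_even_iff_odd.2 hm]
  · simp [zpow_eq_self_of_sq_eq_one_of_odd hg hm, zpow_eq_self_of_sq_eq_one_of_odd hh hn,
      mul_eq_one_iff_eq_inv, hinv, hgh, Int.not_even_iff_odd.2 hm]

theorem phi_eq_negE_order_two_psi (ψ : GL (Fin 2) ℤ) (hord : orderOf ψ = 2)
    (hne : (ψ : M2) ≠ -1) :
    BraceCond (-1) ψ ↔
      Odd ((ψ : M2) 0 0) ∧ Odd ((ψ : M2) 1 1) ∧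
        Even ((ψ : M2) 0 1) ∧ Even ((ψ : M2) 1 0) := by
  have hψ : ψ ^ 2 = 1 := (orderOf_eq_iff two_pos).1 hord |>.1
  have hψ1 : ψ ≠ 1 := by
    rintro rfl
    simp at hord
  have hneg : (-1 : GL (Fin 2) ℤ) ≠ 1 := fun h => by
    have := congrArg (fun g : GL (Fin 2) ℤ => (g : M2) 0 0) h
    norm_num at this
  have hnegψ : -1 ≠ ψ := by
    rintro rfl
    simp at hne
  have key := zpow_mul_zpow_eq_one_iff_even_s18 (neg_one_sq (R := GL (Fin 2) ℤ)) hψ hneg hψ1 hnegψ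
  simp only [BraceCond, key]
  simp [parity_simps]
  tauto
end

section
/- Let φ ∈ GL₂(ℤ) have infinite order and suppose the pair (φ, ψ) satisfies the brace conditions. Then det φ = 1, tr φ = 2, and det ψ = 1. -/
/-- If `x` has infinite order and commutes with `y`, then any two relations
`x ^ m * y ^ n = 1` and `x ^ m' * y ^ n' = 1` have proportional exponent vectors. -/
theorem Commute.mul_exponents_eq_of_zpow_mul_zpow_eq_one {G : Type*} [Group G] {x y : G}
    (hc : Commute x y) (hinf : ∀ n : ℕ, 0 < n → x ^ n ≠ 1) {m n m' n' : ℤ}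
    (h : x ^ m * y ^ n = 1) (h' : x ^ m' * y ^ n' = 1) : m * n' = m' * n := by
  have e : x ^ (m * n') * y ^ (n * n') = 1 := by
    rw [zpow_mul, zpow_mul, ← (hc.zpow_zpow m n).mul_zpow, h, one_zpow]
  have e' : x ^ (m' * n) * y ^ (n * n') = 1 := by
    rw [mul_comm n n', zpow_mul, zpow_mul, ← (hc.zpow_zpow m' n').mul_zpow, h', one_zpow]
  have hx : ¬ IsOfFinOrder x := by
    rw [isOfFinOrder_iff_pow_eq_one]
    rintro ⟨k, hk, hk'⟩
    exact hinf k hk hk'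
  exact injective_zpow_iff_not_isOfFinOrder.mpr hx (mul_right_cancel (e.trans e'.symm))

theorem infinite_order_det_trace (φ ψ : GL (Fin 2) ℤ)
    (hinf : ∀ n : ℕ, 0 < n → φ ^ n ≠ 1)
    (h : BraceCond φ ψ) :
    Matrix.det (φ : M2) = 1 ∧ Matrix.trace (φ : M2) = 2 ∧ Matrix.det (ψ : M2) = 1 := by
  obtain ⟨hc, h₁, h₂, h₃, h₄⟩ := h
  have hφ := Commute.mul_exponents_eq_of_zpow_mul_zpow_eq_one hc hinf h₁ h₂
  have hψ := Commute.mul_exponents_eq_of_zpow_mul_zpow_eq_one hc hinf h₃ h₄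
  have dφ := Int.isUnit_iff.mp ((Matrix.isUnit_iff_isUnit_det _).mp φ.isUnit)
  have dψ := Int.isUnit_iff.mp ((Matrix.isUnit_iff_isUnit_det _).mp ψ.isUnit)
  have hcm : (φ : M2) * (ψ : M2) = (ψ : M2) * (φ : M2) := by
    simpa using congrArg Units.val hc
  have hne : (φ : M2) ≠ 1 := fun H => hinf 1 one_pos (by rw [pow_one]; exact Units.ext H)
  have hsq : (φ : M2) * (φ : M2) ≠ 1 := fun H =>
    hinf 2 two_pos (by rw [pow_two]; exact Units.ext H)
  generalize (φ : M2) = A at *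
  generalize (ψ : M2) = B at *
  have c₀₀ := congrFun (congrFun hcm 0) 0
  have c₀₁ := congrFun (congrFun hcm 0) 1
  have c₁₀ := congrFun (congrFun hcm 1) 0
  simp only [Matrix.mul_apply, Fin.sum_univ_two] at c₀₀ c₀₁ c₁₀
  rw [Matrix.det_fin_two] at dφ dψ
  rw [Matrix.det_fin_two, Matrix.det_fin_two, Matrix.trace_fin_two]
  have detA : A 0 0 * A 1 1 - A 0 1 * A 1 0 = 1 := by
    refine dφ.resolve_right fun H => hsq ?_
    have tr : A 1 1 = -A 0 0 := by linarith
    rw [tr] at H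
    ext i j
    fin_cases i <;> fin_cases j <;> simp [Matrix.mul_apply, Fin.sum_univ_two, tr] <;> linarith
  have trA : A 0 0 + A 1 1 = 2 := by linarith
  refine ⟨detA, trA, dψ.resolve_right fun H => hne ?_⟩
  have trB : B 1 1 = -B 0 0 := by linarith
  obtain ⟨u, hu⟩ : ∃ u, A 0 0 = 1 + u := ⟨A 0 0 - 1, by ring⟩
  have hd : A 1 1 = 1 - u := by linarith
  rw [hu, hd] at c₀₁ c₁₀ detA
  rw [trB] at c₀₁ c₁₀ H
  have e₁ : A 0 1 * B 0 0 = u * B 0 1 := by linarith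
  have e₂ : A 1 0 * B 0 0 = u * B 1 0 := by linarith
  have e₃ : A 0 1 * B 1 0 = B 0 1 * A 1 0 := by linarith
  -- `A - 1` is `t` times the involution `B`, and it is nilpotent, so `t = 0`.
  set t := u * B 0 0 + B 0 1 * A 1 0 with ht
  have tu : t * B 0 0 = u := by grind
  have tb : t * B 0 1 = A 0 1 := by grind
  have tc : t * B 1 0 = A 1 0 := by grind
  have t0 : t = 0 := by
    have : t ^ 2 = 0 := by
      rw [← tu, ← tb, ← tc] at detA
      linear_combination t ^ 2 * H - detA
    exact pow_eq_zero_iff two_ne_zero |>.mp this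
  rw [t0, zero_mul] at tu tb tc
  ext i j
  fin_cases i <;> fin_cases j <;> simp [hu, hd, ← tu, ← tb, ← tc]
end
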